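/- Let S be a tightly connected fundamental inverse semigroup with no isolated nontrivial subgroups and let T be an inverse semigroup. Then the monoids PA(S) and PA(T) are isomorphic if and only if either S and T are isomorphic, or (S, ≤) and (T, ≤) are chains with respect to their natural partial orders and there is a dual order-isomorphism of (S, ≤) onto (T, ≤). -/

import Mathlib

/-- An inverse semigroup: a semigroup in which every element `a` has a unique
element `a⁻¹` with `a * a⁻¹ * a = a` and `a⁻¹ * a * a⁻¹ = a⁻¹`. -/
class InverseSemigroup (S : Type*) extends Semigroup S, Inv S where
  mul_inv_mul : ∀ a : S, a * a⁻¹ * a = a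
  inv_mul_inv : ∀ a : S, a⁻¹ * a * a⁻¹ = a⁻¹
  inv_unique : ∀ a b : S, a * b * a = a → b * a * b = b → b = a⁻¹

section InvSgDefs

variable (S : Type*) [InverseSemigroup S]

/-- The set of idempotents of `S`. -/
def ES : Set S := {e : S | IsIdempotentElem e}

/-- The set of nongroup elements of `S`. -/
def NS : Set S := {x : S | x * x⁻¹ ≠ x⁻¹ * x}

/-- `N_S ∪ E_S`. -/
def NE : Set S := NS S ∪ ES S

variable {S}

/-- The order on idempotents: `e ≤ f` iff `e * f = e`. -/
def idemLe (e f : S) : Prop := e * f = e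

/-- Strict order on idempotents. -/
def idemLt (e f : S) : Prop := idemLe e f ∧ e ≠ f

/-- The natural partial order on an inverse semigroup: `a ≤ b` iff `a = e * b`
for some idempotent `e`. -/
def natLe (a b : S) : Prop := ∃ e : S, IsIdempotentElem e ∧ a = e * b

/-- Green's relation `𝓡`. -/
def rRel (a b : S) : Prop := a * a⁻¹ = b * b⁻¹

/-- Green's relation `𝓛`. -/
def lRel (a b : S) : Prop := a⁻¹ * a = b⁻¹ * b

/-- Green's relation `𝓗`. -/
def hRel (a b : S) : Prop := rRel a b ∧ lRel a b

/-- Green's relation `𝓓`. -/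
def dRel (a b : S) : Prop := ∃ c : S, rRel a c ∧ lRel c b

/-- `U` is an inverse subsemigroup of `S`: closed under multiplication and inversion. -/
def IsInvSub (U : Set S) : Prop :=
  (∀ a ∈ U, ∀ b ∈ U, a * b ∈ U) ∧ ∀ a ∈ U, a⁻¹ ∈ U

/-- The inverse subsemigroup generated by `X`: the smallest subset of `S`
containing `X` and closed under multiplication and inversion. -/
def genInv (X : Set S) : Set S := ⋂₀ {U : Set S | IsInvSub U ∧ X ⊆ U}

/-- `e` is `x`-covered by `x * x⁻¹`: `e < x * x⁻¹` and no idempotent `f` of `⟨x⟩`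
satisfies `e < f < x * x⁻¹`. -/
def XCov (x e : S) : Prop :=
  idemLt e (x * x⁻¹) ∧
    ∀ f ∈ genInv ({x} : Set S), IsIdempotentElem f →
      ¬(idemLt e f ∧ idemLt f (x * x⁻¹))

/-- `e` is tightly `x`-covered by `x * x⁻¹`. -/
def TightXCov (x e : S) : Prop :=
  XCov x e ∧ (e * x ∈ NS S ∨ IsIdempotentElem (e * x))

/-- A short bypass from `e` to `x * x⁻¹`. -/
def ShortBypass (x e : S) : Prop :=
  ∃ n : ℕ, 1 ≤ n ∧ ∃ es : ℕ → S,
    es 0 = e ∧ es n = x * x⁻¹ ∧ (∀ k ≤ n, IsIdempotentElem (es k)) ∧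
    ∀ k : ℕ, 1 ≤ k → k ≤ n → idemLt (es (k - 1)) (es k) ∧ XCov (es k * x) (es (k - 1))

/-- A tight bypass from `e` to `x * x⁻¹`. -/
def TightBypass (x e : S) : Prop :=
  ∃ n : ℕ, 1 ≤ n ∧ ∃ es : ℕ → S,
    es 0 = e ∧ es n = x * x⁻¹ ∧ (∀ k ≤ n, IsIdempotentElem (es k)) ∧
    ∀ k : ℕ, 1 ≤ k → k ≤ n → idemLt (es (k - 1)) (es k) ∧ TightXCov (es k * x) (es (k - 1))

variable (S)

/-- `S` is shortly connected. -/
def ShortlyConnected : Prop :=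
  ∀ x : S, ∀ e : S, IsIdempotentElem e → idemLt e (x * x⁻¹) → ShortBypass x e

/-- `S` is tightly connected. -/
def TightlyConnected : Prop :=
  ∀ x ∈ NE S, ∀ e : S, IsIdempotentElem e → idemLt e (x * x⁻¹) → TightBypass x e

/-- `S` is fundamental. -/
def Fundamental : Prop :=
  ∀ x y : S, (∀ e : S, IsIdempotentElem e → x⁻¹ * e * x = y⁻¹ * e * y) → x = y

/-- `S` is combinatorial. -/
def Combinatorial : Prop :=
  ∀ a b : S, a * a⁻¹ = b * b⁻¹ → a⁻¹ * a = b⁻¹ * b → a = b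

/-- `S` has no isolated nontrivial subgroups: for every idempotent `e` whose
`𝓗`-class is nontrivial there is an idempotent `f ≠ e` with `e 𝓓 f`. -/
def NoIsolatedNontrivial : Prop :=
  ∀ e : S, IsIdempotentElem e → (∃ h : S, h ≠ e ∧ hRel h e) →
    ∃ f : S, IsIdempotentElem f ∧ f ≠ e ∧ dRel e f

/-- `S` is completely semisimple. -/
def CompletelySemisimple : Prop :=
  ∀ e f : S, IsIdempotentElem e → IsIdempotentElem f → idemLe e f → dRel e f → e = f

end InvSgDefs

section PADefs

/-- Composition of partial maps given as graphs (relations): first `α`, then `β`. -/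
def relComp {A : Type*} (α β : Set (A × A)) : Set (A × A) :=
  {p : A × A | ∃ b : A, (p.1, b) ∈ α ∧ (b, p.2) ∈ β}

variable {S : Type*} [InverseSemigroup S]

/-- `α` is (the graph of) a partial automorphism of the inverse semigroup `S`,
i.e. an isomorphism between two inverse subsemigroups of `S` (the empty map
included): `α` is functional, injective, and closed under componentwise
multiplication and inversion. -/
def IsPAGraph (α : Set (S × S)) : Prop :=
  (∀ p ∈ α, ∀ q ∈ α, p.1 = q.1 → p.2 = q.2) ∧
  (∀ p ∈ α, ∀ q ∈ α, p.2 = q.2 → p.1 = q.1) ∧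
  (∀ p ∈ α, ∀ q ∈ α, (p.1 * q.1, p.2 * q.2) ∈ α) ∧
  (∀ p ∈ α, (p.1⁻¹, p.2⁻¹) ∈ α)

theorem IsPAGraph.comp {α β : Set (S × S)} (hα : IsPAGraph α) (hβ : IsPAGraph β) :
    IsPAGraph (relComp α β) := by
  obtain ⟨f1, i1, m1, v1⟩ := hα
  obtain ⟨f2, i2, m2, v2⟩ := hβ
  refine ⟨?_, ?_, ?_, ?_⟩
  · rintro ⟨a, c⟩ ⟨b, hab, hbc⟩ ⟨a', c'⟩ ⟨b', hab', hbc'⟩ h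
    have ha : a = a' := h
    subst ha
    have hb : b = b' := f1 (a, b) hab (a, b') hab' rfl
    subst hb
    exact f2 (b, c) hbc (b, c') hbc' rfl
  · rintro ⟨a, c⟩ ⟨b, hab, hbc⟩ ⟨a', c'⟩ ⟨b', hab', hbc'⟩ h
    have hc : c = c' := h
    subst hc
    have hb : b = b' := i2 (b, c) hbc (b', c) hbc' rfl
    subst hb
    exact i1 (a, b) hab (a', b) hab' rfl
  · rintro ⟨a, c⟩ ⟨b, hab, hbc⟩ ⟨a', c'⟩ ⟨b', hab', hbc'⟩
    exact ⟨b * b', m1 (a, b) hab (a', b') hab', m2 (b, c) hbc (b', c') hbc'⟩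
  · rintro ⟨a, c⟩ ⟨b, hab, hbc⟩
    exact ⟨b⁻¹, v1 (a, b) hab, v2 (b, c) hbc⟩

/-- The partial automorphism monoid of `S`, as a type: its elements are the
graphs of isomorphisms between inverse subsemigroups of `S`. -/
def PA (S : Type*) [InverseSemigroup S] : Type _ := {α : Set (S × S) // IsPAGraph α}

/-- The monoid operation of `PA S`: composition of partial automorphisms. -/
def pacomp (α β : PA S) : PA S := ⟨relComp α.1 β.1, α.2.comp β.2⟩

end PADefs

section Basics

variable {S : Type*} [InverseSemigroup S]

/-- domain idempotent -/
def dm (a : S) : S := a * a⁻¹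
/-- range idempotent -/
def rn (a : S) : S := a⁻¹ * a
/-- conjugation -/
def cj (x e : S) : S := x⁻¹ * e * x

/-- shorthand for idempotents -/
abbrev Idm (e : S) : Prop := IsIdempotentElem e

theorem is_mim (a : S) : a * (a⁻¹ * a) = a := by
  rw [← mul_assoc]; exact InverseSemigroup.mul_inv_mul a
theorem is_imi (a : S) : a⁻¹ * (a * a⁻¹) = a⁻¹ := by
  rw [← mul_assoc]; exact InverseSemigroup.inv_mul_inv a
theorem is_mim' (a b : S) : a * (a⁻¹ * (a * b)) = a * b := by
  rw [← mul_assoc, ← mul_assoc, InverseSemigroup.mul_inv_mul a]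
theorem is_imi' (a b : S) : a⁻¹ * (a * (a⁻¹ * b)) = a⁻¹ * b := by
  rw [← mul_assoc, ← mul_assoc, InverseSemigroup.inv_mul_inv a]
theorem is_uniq {a b : S} (h1 : a * b * a = a) (h2 : b * a * b = b) : b = a⁻¹ :=
  InverseSemigroup.inv_unique a b h1 h2
theorem is_inv_inv (a : S) : (a⁻¹)⁻¹ = a :=
  (is_uniq (InverseSemigroup.inv_mul_inv a) (InverseSemigroup.mul_inv_mul a)).symm
theorem id_inv {e : S} (h : Idm e) : e⁻¹ = e := by
  have h' : e * e = e := h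
  exact (is_uniq (by rw [h', h']) (by rw [h', h'])).symm
theorem id_mul' {e : S} (h : Idm e) (b : S) : e * (e * b) = e * b := by
  have h' : e * e = e := h
  rw [← mul_assoc, h']
theorem id_mulmul {e f : S} (he : Idm e) (hf : Idm f) : Idm (e * f) := by
  have he' : e * e = e := he
  have hf' : f * f = f := hf
  set z := (e * f)⁻¹ with hz
  have h1 : e * (f * (z * (e * f))) = e * f := by
    have := is_mim (e * f); simpa only [mul_assoc] using this
  have h2 : z * (e * (f * z)) = z := by
    have := is_imi (e * f); simpa only [mul_assoc] using this
  have h2' : ∀ b, z * (e * (f * (z * b))) = z * b := by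
    intro b
    have := congrArg (· * b) h2
    simpa only [mul_assoc] using this
  have h3 : f * z * e = z := by
    apply is_uniq (a := e * f)
    · simp only [mul_assoc, id_mul' he, id_mul' hf]; exact h1
    · simp only [mul_assoc, id_mul' he, id_mul' hf, h2']
  have h4 : z * z = z := by
    calc z * z = (f * z * e) * (f * z * e) := by rw [h3]
      _ = f * z * e := by simp only [mul_assoc, h2']
      _ = z := h3
  have h5 : z⁻¹ = z := id_inv h4
  have h6 : z⁻¹ = e * f := is_inv_inv _
  rw [← h6, h5]; exact h4
theorem id_comm {e f : S} (he : Idm e) (hf : Idm f) : e * f = f * e := by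
  have h1 : (e * f) * (e * f) = e * f := id_mulmul he hf
  have h2 : (f * e) * (f * e) = f * e := id_mulmul hf he
  have h3 : f * e = (e * f)⁻¹ := by
    apply is_uniq
    · simp only [mul_assoc, id_mul' he, id_mul' hf] at *; exact h1
    · simp only [mul_assoc, id_mul' he, id_mul' hf] at *; exact h2
  rw [id_inv (id_mulmul he hf)] at h3
  exact h3.symm
theorem id_dm (a : S) : Idm (dm a) := by
  show a * a⁻¹ * (a * a⁻¹) = a * a⁻¹
  simp only [mul_assoc, is_mim', is_imi]
theorem id_rn (a : S) : Idm (rn a) := by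
  show a⁻¹ * a * (a⁻¹ * a) = a⁻¹ * a
  simp only [mul_assoc, is_imi', is_mim]
theorem is_mul_inv (a b : S) : (a * b)⁻¹ = b⁻¹ * a⁻¹ := by
  have hc : dm b * rn a = rn a * dm b := id_comm (id_dm b) (id_rn a)
  simp only [dm, rn, mul_assoc] at hc
  have hc1 : ∀ u, b * (b⁻¹ * (a⁻¹ * (a * u))) = a⁻¹ * (a * (b * (b⁻¹ * u))) := by
    intro u
    have := congrArg (· * u) hc
    simpa only [mul_assoc] using this
  symm
  apply is_uniq
  · simp only [mul_assoc, hc1, is_mim', is_mim]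
  · simp only [mul_assoc, ← hc1, is_imi', is_imi]
theorem dm_inv (a : S) : dm a⁻¹ = rn a := by simp only [dm, rn, is_inv_inv]
theorem rn_inv (a : S) : rn a⁻¹ = dm a := by simp only [dm, rn, is_inv_inv]
theorem dm_id {e : S} (h : Idm e) : dm e = e := by
  rw [dm, id_inv h]; exact h
theorem rn_id {e : S} (h : Idm e) : rn e = e := by
  rw [rn, id_inv h]; exact h
theorem dm_self (a : S) : dm a * a = a := InverseSemigroup.mul_inv_mul a
theorem rn_self (a : S) : a * rn a = a := is_mim a
theorem le_rfl' {e : S} (h : Idm e) : idemLe e e := h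
theorem le_tr {e f g : S} (h1 : idemLe e f) (h2 : idemLe f g) : idemLe e g := by
  unfold idemLe at *
  rw [← h1, mul_assoc, h2]
theorem le_anti {e f : S} (he : Idm e) (hf : Idm f) (h1 : idemLe e f) (h2 : idemLe f e) : e = f := by
  unfold idemLe at *
  rw [← h1, id_comm he hf, h2]
theorem le_left {e f : S} (he : Idm e) (hf : Idm f) (h : idemLe e f) : f * e = e := by
  rw [id_comm hf he]; exact h
theorem mul_le_l {e f : S} (he : Idm e) (hf : Idm f) : idemLe (e * f) e := by
  unfold idemLe
  rw [id_comm he hf, mul_assoc, he]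
theorem mul_le_r {e f : S} (_he : Idm e) (hf : Idm f) : idemLe (e * f) f := by
  unfold idemLe
  rw [mul_assoc, hf]
theorem le_mul {e f g : S} (h1 : idemLe e f) (h2 : idemLe e g) : idemLe e (f * g) := by
  unfold idemLe at *
  rw [← mul_assoc, h1, h2]

theorem mul_cj {e : S} (he : Idm e) (x : S) : e * x = x * cj x e := by
  have hc : dm x * e = e * dm x := id_comm (id_dm x) he
  calc e * x = e * (dm x * x) := by rw [dm_self]
    _ = (dm x * e) * x := by rw [hc, mul_assoc]
    _ = x * cj x e := by simp only [dm, cj, mul_assoc]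
theorem id_cj {e : S} (he : Idm e) (x : S) : Idm (cj x e) := by
  show x⁻¹ * e * x * cj x e = cj x e
  rw [mul_assoc, ← mul_cj he, cj, ← mul_assoc, mul_assoc x⁻¹ e e, he]
theorem cj_mul {e f : S} (_he : Idm e) (hf : Idm f) (x : S) : cj x (e * f) = cj x e * cj x f := by
  have : x⁻¹ * e * x * cj x f = x⁻¹ * e * (f * x) := by rw [mul_assoc, ← mul_cj hf]
  rw [show cj x e = x⁻¹ * e * x from rfl, this]; simp only [cj, mul_assoc]
theorem cj_mono {e f : S} (he : Idm e) (hf : Idm f) (x : S) (h : idemLe e f) :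
    idemLe (cj x e) (cj x f) := by
  unfold idemLe at *
  rw [← cj_mul he hf, h]
theorem cj_cj (x y e : S) : cj y (cj x e) = cj (x * y) e := by
  simp only [cj, is_mul_inv, mul_assoc]
theorem cj_inv (x e : S) : cj x⁻¹ e = x * e * x⁻¹ := by simp only [cj, is_inv_inv]
theorem cj_dm (x : S) : cj x (dm x) = rn x := by
  simp only [cj, dm, rn, mul_assoc, is_imi']
theorem cj_back {e : S} (he : Idm e) (x : S) : cj x⁻¹ (cj x e) = e * dm x := by
  rw [cj_inv, ← mul_cj he]; simp only [dm, mul_assoc]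
theorem cj_back' {e : S} (he : Idm e) (x : S) : cj x (cj x⁻¹ e) = e * rn x := by
  have := cj_back he x⁻¹
  rwa [is_inv_inv, dm_inv] at this
theorem dm_mul (a b : S) : dm (a * b) = cj a⁻¹ (dm b) := by
  simp only [cj_inv, dm, is_mul_inv, mul_assoc]
theorem rn_mul (a b : S) : rn (a * b) = cj b (rn a) := by
  simp only [cj, rn, is_mul_inv, mul_assoc]
theorem cj_le {e : S} (_he : Idm e) (x : S) : idemLe (cj x e) (rn x) := by
  unfold idemLe
  simp only [cj, rn, mul_assoc, is_mim]
theorem dm_mul_le (a b : S) : idemLe (dm (a * b)) (dm a) := by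
  rw [dm_mul, ← rn_inv a]; exact cj_le (id_dm b) _
theorem rn_mul_le (a b : S) : idemLe (rn (a * b)) (rn b) := by
  rw [rn_mul]; exact cj_le (id_rn a) _
theorem dm_idmul {e : S} (he : Idm e) (x : S) : dm (e * x) = e * dm x := by
  rw [dm_mul, cj, is_inv_inv, id_inv he, mul_assoc, id_comm (id_dm x) he, ← mul_assoc, he]
theorem rn_idmul {e : S} (he : Idm e) (x : S) : rn (e * x) = cj x e := by
  rw [rn_mul, rn_id he]
theorem cj_res {e : S} (he : Idm e) (x : S) : cj x (e * dm x) = cj x e := by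
  rw [cj_mul he (id_dm x), cj_dm]; exact cj_le he x
theorem cj_res' {e : S} (he : Idm e) (x : S) : cj x (dm x * e) = cj x e := by
  rw [id_comm (id_dm x) he, cj_res he]
theorem dm_mul_eq {a b : S} (h : idemLe (rn a) (dm b)) : dm (a * b) = dm a := by
  rw [dm_mul, ← cj_res (id_dm b), dm_inv, id_comm (id_dm b) (id_rn a), h, ← dm_inv, cj_dm, rn_inv]
theorem rn_mul_eq {a b : S} (h : idemLe (dm b) (rn a)) : rn (a * b) = rn b := by
  rw [rn_mul, ← cj_res (id_rn a), id_comm (id_rn a) (id_dm b), h, cj_dm]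
theorem le_of_dm_mul {a b : S} (h : dm (a * b) = dm a) : idemLe (rn a) (dm b) := by
  have : cj a (dm (a * b)) = rn a := by rw [h, cj_dm]
  rw [dm_mul, cj_back' (id_dm b)] at this
  unfold idemLe
  rw [← this, mul_assoc, id_comm (id_rn a) (id_dm b), ← mul_assoc, id_dm b]
theorem mul_of_rn_le {a e : S} (h : idemLe (rn a) e) : a * e = a := by
  calc a * e = a * rn a * e := by rw [rn_self]
    _ = a := by rw [mul_assoc, h, rn_self]
theorem dm_mul_of_le {a e : S} (he : Idm e) (h : idemLe (dm a) e) : e * a = a := by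
  calc e * a = e * dm a * a := by rw [mul_assoc, dm_self]
    _ = a := by rw [le_left (id_dm a) he h, dm_self]
theorem cj_le_iff {e k : S} (he : Idm e) (hk : Idm k) (x : S) (hd : idemLe e (dm x))
    (h : idemLe (cj x e) k) : idemLe e (cj x⁻¹ k) := by
  have := cj_mono (id_cj he x) hk x⁻¹ h
  rw [cj_back he, hd] at this; exact this
theorem id_of_dm_rn {t : S} (h : Idm t) : t = dm t := (dm_id h).symm

/-! generated subsemigroups -/
theorem gen_sub (X : Set S) : IsInvSub (genInv X) := by
  refine ⟨fun a ha b hb U hU => hU.1.1 a (ha U hU) b (hb U hU), fun a ha U hU => hU.1.2 a (ha U hU)⟩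
theorem gen_self (X : Set S) : X ⊆ genInv X := fun _ hx _ hU => hU.2 hx
theorem gen_le {X U : Set S} (hU : IsInvSub U) (h : X ⊆ U) : genInv X ⊆ U := fun _ hw => hw U ⟨hU, h⟩
theorem gen_ind {X : Set S} (P : S → Prop) (h1 : ∀ x ∈ X, P x) (h2 : ∀ x ∈ X, P x⁻¹)
    (hm : ∀ a b, P a → P b → P (a * b)) : ∀ w ∈ genInv X, P w := by
  have hs : IsInvSub {w : S | P w ∧ P w⁻¹} := by
    refine ⟨fun a ha b hb => ⟨hm _ _ ha.1 hb.1, ?_⟩, fun a ha => ⟨ha.2, ?_⟩⟩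
    · rw [is_mul_inv]; exact hm _ _ hb.2 ha.2
    · rw [is_inv_inv]; exact ha.1
  intro w hw
  exact (gen_le hs (fun x hx => ⟨h1 x hx, h2 x hx⟩) hw).1
theorem gen1 (x : S) : x ∈ genInv ({x} : Set S) := gen_self _ rfl
theorem sub_dm {U : Set S} (h : IsInvSub U) {a : S} (ha : a ∈ U) : dm a ∈ U := h.1 _ ha _ (h.2 _ ha)
theorem sub_rn {U : Set S} (h : IsInvSub U) {a : S} (ha : a ∈ U) : rn a ∈ U := h.1 _ (h.2 _ ha) _ ha
theorem gen1_le {U : Set S} (hU : IsInvSub U) {x : S} (h : x ∈ U) : genInv {x} ⊆ U :=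
  gen_le hU (by rintro _ rfl; exact h)
theorem gen_inv (x : S) : genInv ({x⁻¹} : Set S) = genInv {x} := by
  apply Set.Subset.antisymm
  · exact gen1_le (gen_sub _) ((gen_sub _).2 _ (gen1 x))
  · apply gen1_le (gen_sub _)
    have := (gen_sub _).2 _ (gen1 x⁻¹)
    rwa [is_inv_inv] at this
theorem gen_dm (x : S) : genInv ({x, dm x} : Set S) = genInv {x} := by
  apply Set.Subset.antisymm
  · apply gen_le (gen_sub _)
    rintro _ (rfl | rfl)
    · exact gen1 _
    · exact sub_dm (gen_sub _) (gen1 _)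
  · exact gen1_le (gen_sub _) (gen_self _ (Or.inl rfl))
theorem gen_id {e : S} (he : Idm e) : genInv ({e} : Set S) = {e} := by
  apply Set.Subset.antisymm
  · refine gen1_le (U := {e}) ?_ rfl
    refine ⟨?_, ?_⟩
    · rintro _ rfl _ rfl; exact he
    · rintro _ rfl; exact id_inv he
  · exact gen_self _
theorem sub_es : IsInvSub (ES S) := by
  refine ⟨fun a ha b hb => id_mulmul ha hb, fun a ha => ?_⟩
  have h : Idm a := ha
  rw [id_inv h]; exact ha
theorem gen_top {x w : S} (hw : w ∈ genInv ({x} : Set S)) :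
    idemLe (dm w) (dm x) ∨ idemLe (dm w) (rn x) := by
  refine gen_ind (fun w => idemLe (dm w) (dm x) ∨ idemLe (dm w) (rn x)) ?_ ?_ ?_ w hw
  · rintro _ rfl; exact Or.inl (le_rfl' (id_dm _))
  · rintro _ rfl; rw [dm_inv]; exact Or.inr (le_rfl' (id_rn _))
  · intro a b ha _
    exact ha.imp (le_tr (dm_mul_le a b)) (le_tr (dm_mul_le a b))
theorem gen_group {x : S} (h : dm x = rn x) {w : S} (hw : w ∈ genInv ({x} : Set S)) :
    dm w = dm x ∧ rn w = dm x := by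
  refine gen_ind (fun w => dm w = dm x ∧ rn w = dm x) ?_ ?_ ?_ w hw
  · rintro _ rfl; exact ⟨rfl, h.symm⟩
  · rintro _ rfl; rw [dm_inv, rn_inv]; exact ⟨h.symm, rfl⟩
  · intro a b ha hb
    constructor
    · rw [dm_mul_eq, ha.1]; rw [ha.2, hb.1]; exact id_dm _
    · rw [rn_mul_eq, hb.2]; rw [ha.2, hb.1]; exact id_dm _
theorem ns_iff {x : S} : x ∈ NS S ↔ dm x ≠ rn x := Iff.rfl
theorem ns_inv {x : S} (h : x ∈ NS S) : x⁻¹ ∈ NS S := by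
  rw [ns_iff] at *; rw [dm_inv, rn_inv]; exact h.symm

/-- `c x^k` -/
def qp (c x : S) : ℕ → S
  | 0 => c
  | (n + 1) => qp c x n * x

theorem dm_qp_le {c : S} (hc : Idm c) (x : S) (k : ℕ) : idemLe (dm (qp c x k)) c := by
  induction k with
  | zero => rw [qp, dm_id hc]; exact hc
  | succ n ih => exact le_tr (dm_mul_le _ _) ih

theorem path_lemma {c x : S} (hc : Idm c) (h2 : ¬ idemLe c (rn x))
    {w : S} (hw : w ∈ genInv ({x, c} : Set S)) (hd : dm w = c) : ∃ k, w = qp c x k := by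
  have key : ∀ u ∈ genInv ({x, c} : Set S), ∀ p, ((∃ k, p = qp c x k) ∧ dm p = c) →
      dm (p * u) = c → ∃ k, p * u = qp c x k := by
    apply gen_ind
    · rintro u (rfl | rfl)
      · rintro p ⟨⟨k, rfl⟩, _⟩ _
        exact ⟨k + 1, rfl⟩
      · rintro p ⟨⟨k, hk⟩, h⟩ h'
        refine ⟨k, ?_⟩
        have := le_of_dm_mul (h'.trans h.symm)
        rw [dm_id hc] at this
        rw [mul_of_rn_le this, hk]
    · rintro u (rfl | rfl)
      · rintro p ⟨⟨k, hk⟩, h⟩ h'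
        have h3 := le_of_dm_mul (h'.trans h.symm)
        rw [dm_inv] at h3
        cases k with
        | zero =>
          rw [qp] at hk; subst hk
          rw [rn_id hc] at h3; exact absurd h3 h2
        | succ n =>
          refine ⟨n, ?_⟩
          rw [qp] at hk
          have h4 : dm (qp c u n) = c := by
            apply le_anti (id_dm _) hc (dm_qp_le hc _ _)
            have := dm_mul_le (qp c u n) u
            rwa [← hk, h] at this
          have h5 : idemLe (rn (qp c u n)) (dm u) := by
            apply le_of_dm_mul; rw [← hk, h, h4]
          rw [hk, mul_assoc]; exact mul_of_rn_le h5
      · rw [id_inv hc]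
        rintro p ⟨⟨k, hk⟩, h⟩ h'
        refine ⟨k, ?_⟩
        have := le_of_dm_mul (h'.trans h.symm)
        rw [dm_id hc] at this
        rw [mul_of_rn_le this, hk]
    · intro a b ha hb p hp h
      rw [← mul_assoc] at h ⊢
      have h1 : dm (p * a) = c := by
        apply le_anti (id_dm _) hc
        · rw [← hp.2]; exact dm_mul_le _ _
        · have := dm_mul_le (p * a) b
          rwa [h] at this
      exact hb _ ⟨ha p hp h1, h1⟩ h
  have hcw : c * w = w := by
    apply dm_mul_of_le hc; rw [hd]; exact hc
  obtain ⟨k, hk⟩ := key w hw c ⟨⟨0, rfl⟩, dm_id hc⟩ (by rw [hcw, hd])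
  exact ⟨k, by rw [← hcw, hk]⟩

theorem qp_two_rn (c x : S) (k : ℕ) : idemLe (rn (qp c x (k + 2))) (rn (x * x)) := by
  rw [qp, qp, mul_assoc]; exact rn_mul_le _ _
theorem qp_two_dm {c x : S} (hc : Idm c) (_hcx : idemLe c (dm x)) (k : ℕ)
    (h : dm (qp c x (k + 2)) = c) : idemLe c (dm (x * x)) := by
  have h1 : ∀ k, idemLe (dm (qp c x (k + 2))) (dm (qp c x 2)) := by
    intro k
    induction k with
    | zero => exact le_rfl' (id_dm _)
    | succ n ih => exact le_tr (dm_mul_le _ _) ih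
  have h2 := h1 k
  rw [h] at h2
  have h3 : dm (qp c x 2) = c * dm (x * x) := by
    show dm (c * x * x) = _
    rw [mul_assoc, dm_idmul hc]
  rw [h3] at h2
  exact le_tr h2 (mul_le_r hc (id_dm _))

/-- not below the range: `r(cx)` is not below `r(xx)` -/
theorem not_le_rn_sq {c x : S} (hc : Idm c) (h1 : idemLe c (dm x)) (h2 : ¬ idemLe c (rn x)) :
    ¬ idemLe (cj x c) (rn (x * x)) := by
  intro h
  apply h2
  have := cj_le_iff hc (id_rn _) x h1 h
  rw [rn_mul, cj_back (id_rn x)] at this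
  exact le_tr this (mul_le_l (id_rn _) (id_dm _))

theorem rn_not_of_par {x : S} (h : ¬ idemLe (rn x) (dm x)) {w : S}
    (h' : ¬ idemLe (dm x) (rn x))
    (hw : w ∈ genInv ({x} : Set S)) (hd : dm w = dm x) : w = dm x ∨ w = x := by
  rw [← gen_dm] at hw
  obtain ⟨k, hk⟩ := path_lemma (id_dm x) h' hw hd
  match k, hk with
  | 0, hk => exact Or.inl hk
  | 1, hk => right; rw [hk]; exact dm_self x
  | k + 2, hk =>
    exfalso
    apply h
    have h1 := qp_two_dm (id_dm x) (le_rfl' (id_dm x)) k (by rw [← hk, hd])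
    apply le_of_dm_mul
    exact le_anti (id_dm _) (id_dm _) (dm_mul_le _ _) h1

end Basics
section Omega

variable {S : Type*} [InverseSemigroup S]

/-- an inverse subsemigroup whose idempotents form a descending omega-chain -/
structure Om (U : Set S) (ε : ℕ → S) : Prop where
  sub : IsInvSub U
  idm : ∀ i, Idm (ε i)
  mem : ∀ i, ε i ∈ U
  mul : ∀ i j, ε i * ε j = ε (max i j)
  inj : Function.Injective ε
  all : ∀ w ∈ U, Idm w → ∃ i, w = ε i

theorem Om.le_iff {U : Set S} {ε : ℕ → S} (h : Om U ε) (i j : ℕ) : idemLe (ε i) (ε j) ↔ j ≤ i := by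
  unfold idemLe
  rw [h.mul, h.inj.eq_iff]; exact max_eq_left_iff

theorem Om.shift {U : Set S} {ε : ℕ → S} (h : Om U ε) {t : S} (ht : t ∈ U) {p q : ℕ}
    (hp : dm t = ε p) (hq : rn t = ε q) (k : ℕ) : cj t (ε (p + k)) = ε (q + k) := by
  have hmem : ∀ s ∈ U, ∀ i, ∃ j, cj s (ε i) = ε j := by
    intro s hs i
    apply h.all
    · exact h.sub.1 _ (h.sub.1 _ (h.sub.2 _ hs) _ (h.mem i)) _ hs
    · exact id_cj (h.idm i) s
  induction k with
  | zero => rw [add_zero, add_zero, ← hp, cj_dm, hq]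
  | succ k ih =>
    obtain ⟨m, hm⟩ := hmem t ht (p + (k + 1))
    obtain ⟨n, hn⟩ := hmem t⁻¹ (h.sub.2 _ ht) (q + (k + 1))
    have hb : ∀ i, cj t⁻¹ (cj t (ε (p + i))) = ε (p + i) := by
      intro i
      rw [cj_back (h.idm _), hp, h.mul]; congr 1; omega
    have hb' : cj t (ε n) = ε (q + (k + 1)) := by
      rw [← hn, cj_back' (h.idm _), hq, h.mul]; congr 1; omega
    have h1 : q + k ≤ m := by
      rw [← h.le_iff, ← hm, ← ih]
      exact cj_mono (h.idm _) (h.idm _) t ((h.le_iff _ _).2 (by omega))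
    have h2 : m ≠ q + k := by
      rintro rfl
      have h3 := hb (k + 1)
      rw [hm, ← ih, hb] at h3
      have := h.inj h3; omega
    rw [hm]; congr 1
    by_contra hne
    have h3 : p + k ≤ n := by
      rw [← h.le_iff, ← hn, ← hb k, ih]
      exact cj_mono (h.idm _) (h.idm _) _ ((h.le_iff _ _).2 (by omega))
    have h4 : n ≤ p + (k + 1) := by
      rw [← h.le_iff, ← hn, ← hb (k + 1), hm]
      exact cj_mono (h.idm _) (h.idm _) _ ((h.le_iff _ _).2 (by omega))
    have h5 : n = p + k ∨ n = p + (k + 1) := by omega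
    rcases h5 with rfl | rfl
    · rw [ih] at hb'
      have := h.inj hb'; omega
    · rw [hm] at hb'
      exact hne (h.inj hb')

theorem Om.dmm {U : Set S} {ε : ℕ → S} (h : Om U ε) {a b : S} (ha : a ∈ U) {i j k l : ℕ}
    (h1 : dm a = ε i) (h2 : rn a = ε j) (h3 : dm b = ε k) (_h4 : rn b = ε l) :
    dm (a * b) = ε (i + (max j k - j)) := by
  rw [dm_mul, ← cj_res (id_dm b), dm_inv, h3, h2, h.mul]
  have := h.shift (h.sub.2 _ ha) (p := j) (q := i) (by rw [dm_inv, h2]) (by rw [rn_inv, h1]) (max j k - j)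
  rw [← this]; congr 2; omega

theorem Om.rnm {U : Set S} {ε : ℕ → S} (h : Om U ε) {a b : S} (hb : b ∈ U) {i j k l : ℕ}
    (_h1 : dm a = ε i) (h2 : rn a = ε j) (h3 : dm b = ε k) (h4 : rn b = ε l) :
    rn (a * b) = ε (l + (max j k - k)) := by
  rw [rn_mul, ← cj_res (id_rn a), h3, h2, h.mul]
  have := h.shift hb h3 h4 (max j k - k)
  rw [← this]; congr 2; omega

theorem Om.ex {U : Set S} {ε : ℕ → S} (h : Om U ε) {a : S} (ha : a ∈ U) :
    (∃ i, dm a = ε i) ∧ ∃ j, rn a = ε j :=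
  ⟨h.all _ (sub_dm h.sub ha) (id_dm a), h.all _ (sub_rn h.sub ha) (id_rn a)⟩

/-- idempotents of a bicyclic semigroup -/
def bep (x : S) (n : ℕ) : S := rn (qp (dm x) x n)

theorem id_bep (x : S) (n : ℕ) : Idm (bep x n) := id_rn _

theorem bep_zero (x : S) : bep x 0 = dm x := rn_id (id_dm x)
theorem bep_succ (x : S) (n : ℕ) : bep x (n + 1) = cj x (bep x n) := by
  rw [bep, qp, rn_mul, bep]
theorem bep_one (x : S) : bep x 1 = rn x := by rw [bep_succ, bep_zero, cj_dm]
theorem bep_two (x : S) : bep x 2 = rn (x * x) := by rw [bep_succ, bep_one, rn_mul]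

theorem bep_le {x : S} (h : idemLe (rn x) (dm x)) (n : ℕ) : idemLe (bep x (n + 1)) (bep x n) := by
  induction n with
  | zero => rw [bep_one, bep_zero]; exact h
  | succ n ih =>
    have := cj_mono (id_bep x (n + 1)) (id_bep x n) x ih
    rwa [← bep_succ, ← bep_succ] at this
theorem bep_anti {x : S} (h : idemLe (rn x) (dm x)) {i j : ℕ} (hij : i ≤ j) :
    idemLe (bep x j) (bep x i) := by
  induction hij with
  | refl => exact le_rfl' (id_rn _)
  | step _ ih => exact le_tr (bep_le h _) ih
theorem bep_ne {x : S} (h : idemLe (rn x) (dm x)) (hne : dm x ≠ rn x) (n : ℕ) :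
    bep x (n + 1) ≠ bep x n := by
  induction n with
  | zero => rw [bep_one, bep_zero]; exact hne.symm
  | succ n ih =>
    intro he
    apply ih
    have h1 : ∀ m, cj x⁻¹ (bep x (m + 1)) = bep x m := by
      intro m
      rw [bep_succ, cj_back (id_bep _ _)]
      have := bep_anti h (Nat.zero_le m)
      rw [bep_zero] at this; exact this
    rw [← h1 (n + 1), ← h1 n, he]
theorem bep_inj {x : S} (h : idemLe (rn x) (dm x)) (hne : dm x ≠ rn x) :
    Function.Injective (bep x) := by
  have key : ∀ i j, i < j → bep x i ≠ bep x j := by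
    intro i j hij he
    have h1 := bep_anti h (Nat.succ_le_of_lt hij)
    rw [← he] at h1
    exact bep_ne h hne i (le_anti (id_rn _) (id_rn _) (bep_le h i) h1)
  intro i j he
  rcases lt_trichotomy i j with h1 | h1 | h1
  · exact absurd he (key _ _ h1)
  · exact h1
  · exact absurd he.symm (key _ _ h1)

theorem gen_dm_le {x : S} (h : idemLe (rn x) (dm x)) {w : S} (hw : w ∈ genInv ({x} : Set S)) :
    idemLe (dm w) (dm x) := by
  rcases gen_top hw with h1 | h1
  · exact h1
  · exact le_tr h1 h

theorem qp_mem (x : S) (n : ℕ) : qp (dm x) x n ∈ genInv ({x} : Set S) := by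
  induction n with
  | zero => exact sub_dm (gen_sub _) (gen1 _)
  | succ n ih => exact (gen_sub _).1 _ ih _ (gen1 _)

theorem om_bi {x : S} (h : idemLe (rn x) (dm x)) (hne : dm x ≠ rn x) :
    Om (genInv ({x} : Set S)) (bep x) where
  sub := gen_sub _
  idm := fun _ => id_rn _
  mem := fun n => sub_rn (gen_sub _) (qp_mem x n)
  mul := by
    intro i j
    rcases le_total i j with h1 | h1
    · rw [max_eq_right h1]; exact le_left (id_rn _) (id_rn _) (bep_anti h h1)
    · rw [max_eq_left h1]; exact bep_anti h h1
  inj := bep_inj h hne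
  all := by
    have key : ∀ w ∈ genInv ({x} : Set S), ∀ n, ∃ m, cj w (bep x n) = bep x m := by
      apply gen_ind
      · rintro _ rfl n
        exact ⟨n + 1, (bep_succ _ n).symm⟩
      · rintro w rfl n
        cases n with
        | zero =>
          refine ⟨0, ?_⟩
          have : dm w * rn w = rn w := le_left (id_rn _) (id_dm _) h
          rw [bep_zero, ← cj_res (id_dm w), dm_inv, this, ← dm_inv, cj_dm, rn_inv]
        | succ n =>
          refine ⟨n, ?_⟩
          rw [bep_succ, cj_back (id_bep _ _)]
          have := bep_anti h (Nat.zero_le n)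
          rw [bep_zero] at this; exact this
      · intro a b ha hb n
        obtain ⟨m, hm⟩ := ha n
        obtain ⟨k, hk⟩ := hb m
        exact ⟨k, by rw [← cj_cj, hm, hk]⟩
    intro w hw hi
    obtain ⟨m, hm⟩ := key w hw 0
    refine ⟨m, ?_⟩
    rw [← hm, bep_zero, cj, id_inv hi]
    have h1 := gen_dm_le h hw
    rw [dm_id hi] at h1
    rw [h1, hi]

/-- the bicyclic semigroup has trivial subgroups -/
theorem bi_comb {x : S} (h : idemLe (rn x) (dm x)) (hne : dm x ≠ rn x) {t : S}
    (ht : t ∈ genInv ({x} : Set S)) (hg : dm t = rn t) : Idm t := by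
  have ho := om_bi h hne
  obtain ⟨⟨i, hi⟩, -⟩ := ho.ex ht
  have hnle : ¬ idemLe (dm x) (rn x) := fun h' => hne (le_anti (id_dm _) (id_rn _) h' h)
  set p := qp (dm x) x i with hp
  have hrp : rn p = dm t := hi.symm
  have hdq : ∀ n, dm (qp (dm x) x n) = dm x := by
    intro n
    induction n with
    | zero => exact dm_id (id_dm x)
    | succ n ih =>
      rw [qp, dm_mul_eq, ih]
      have := bep_anti h (Nat.zero_le n)
      rw [bep_zero] at this; exact this
  have h1 : dm (p * t) = dm x := by
    rw [dm_mul_eq (by rw [hrp]; exact id_dm t), hp, hdq]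
  have h2 : p * t ∈ genInv ({x, dm x} : Set S) := by
    rw [gen_dm]; exact (gen_sub _).1 _ (qp_mem x i) _ ht
  obtain ⟨k, hk⟩ := path_lemma (id_dm x) hnle h2 h1
  have h3 : rn (p * t) = bep x i := by
    rw [rn_mul_eq (by rw [hrp]; exact id_dm t), ← hg, hi]
  rw [hk] at h3
  have h4 : k = i := ho.inj h3
  rw [h4, ← hp] at hk
  have h5 : t = rn p := by
    calc t = dm t * t := (dm_self t).symm
      _ = p⁻¹ * (p * t) := by rw [← hrp, rn, mul_assoc]
      _ = rn p := by rw [hk, rn]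
  rw [h5]; exact id_rn p

theorem comb_eq {U : Set S} (hU : IsInvSub U) (hc : ∀ t ∈ U, dm t = rn t → Idm t) {a b : S}
    (ha : a ∈ U) (hb : b ∈ U) (h1 : dm a = dm b) (h2 : rn a = rn b) : a = b := by
  have h3 : dm (a * b⁻¹) = dm a := dm_mul_eq (by rw [dm_inv, h2]; exact id_rn b)
  have h4 : rn (a * b⁻¹) = dm a := by
    rw [rn_mul_eq (by rw [dm_inv, h2]; exact id_rn b), rn_inv, h1]
  have h5 : Idm (a * b⁻¹) := hc _ (hU.1 _ ha _ (hU.2 _ hb)) (h3.trans h4.symm)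
  have h6 : a * b⁻¹ = dm a := by rw [← h3, dm_id h5]
  calc a = a * (b⁻¹ * b) := by
        have := rn_self a
        rw [h2] at this; exact this.symm
    _ = dm b * b := by rw [← mul_assoc, h6, h1]
    _ = b := dm_self b

end Omega
section Lat

variable {S T : Type*} [InverseSemigroup S] [InverseSemigroup T]

/-- inverse subsemigroups -/
abbrev Sb (S : Type*) [InverseSemigroup S] := {U : Set S // IsInvSub U}

/-- generated inverse subsemigroup, bundled -/
def GG (X : Set S) : Sb S := ⟨genInv X, gen_sub X⟩

theorem GG_le {X : Set S} {U : Sb S} : GG X ≤ U ↔ X ⊆ U.1 :=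
  ⟨fun h => (gen_self X).trans h, fun h => gen_le U.2 h⟩
theorem GG1_le {x : S} {U : Sb S} : GG {x} ≤ U ↔ x ∈ U.1 := by
  rw [GG_le, Set.singleton_subset_iff]
theorem GG2_le {x c : S} {U : Sb S} : GG {x, c} ≤ U ↔ x ∈ U.1 ∧ c ∈ U.1 := by
  rw [GG_le, Set.insert_subset_iff, Set.singleton_subset_iff]

/-- a lattice isomorphism together with the induced bijection of idempotents -/
structure LB (S T : Type*) [InverseSemigroup S] [InverseSemigroup T] where
  Ψ : Sb S ≃o Sb T
  ψ : S → T
  ψi : T → S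
  idm : ∀ e, Idm e → Idm (ψ e)
  idmi : ∀ e, Idm e → Idm (ψi e)
  left : ∀ e, Idm e → ψi (ψ e) = e
  right : ∀ e, Idm e → ψ (ψi e) = e
  mem : ∀ U : Sb S, ∀ e, Idm e → (e ∈ U.1 ↔ ψ e ∈ (Ψ U).1)

namespace LB

variable (L : LB S T)

/-- inverse -/
def symm : LB T S where
  Ψ := L.Ψ.symm
  ψ := L.ψi
  ψi := L.ψ
  idm := L.idmi
  idmi := L.idm
  left := L.right
  right := L.left
  mem := by
    intro U e he
    rw [L.mem (L.Ψ.symm U) _ (L.idmi e he), L.right e he, OrderIso.apply_symm_apply]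

theorem inj {e f : S} (he : Idm e) (hf : Idm f) (h : L.ψ e = L.ψ f) : e = f := by
  rw [← L.left e he, ← L.left f hf, h]

theorem memi (U : Sb S) {e : T} (he : Idm e) : e ∈ (L.Ψ U).1 ↔ L.ψi e ∈ U.1 := by
  rw [L.mem U _ (L.idmi e he), L.right e he]

theorem memi' (U : Sb T) {e : S} (he : Idm e) : e ∈ (L.Ψ.symm U).1 ↔ L.ψ e ∈ U.1 :=
  L.symm.memi U he

theorem psi_id {e : S} (he : Idm e) : L.Ψ (GG {e}) = GG {L.ψ e} := by
  apply le_antisymm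
  · rw [← OrderIso.le_symm_apply, GG1_le, L.memi' _ he]; exact gen1 _
  · rw [GG1_le, ← L.mem _ _ he]; exact gen1 _

theorem psi_two {x c : S} {y : T} (h : L.Ψ (GG {x}) = GG {y}) (hc : Idm c) :
    L.Ψ (GG {x, c}) = GG {y, L.ψ c} := by
  apply le_antisymm
  · rw [← OrderIso.le_symm_apply, GG2_le]
    constructor
    · rw [← GG1_le, OrderIso.le_symm_apply, h, GG1_le]; exact gen_self _ (by simp)
    · rw [L.memi' _ hc]; exact gen_self _ (by simp)
  · rw [GG2_le]
    constructor
    · rw [← GG1_le, ← h, OrderIso.le_iff_le, GG1_le]; exact gen_self _ (by simp)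
    · rw [← L.mem _ _ hc]; exact gen_self _ (by simp)

theorem group_lem {V : Sb S} {z k : T} (hz : z ∈ (L.Ψ V).1) (h1 : dm z = k) (h2 : rn z = k)
    (h : ∀ a ∈ V.1, dm a = L.ψi k → rn a = L.ψi k → a = L.ψi k) : z = k := by
  have hk : Idm k := by rw [← h1]; exact id_dm z
  have hPV : L.Ψ.symm (GG {z}) ≤ V := by
    rw [OrderIso.symm_apply_le, GG1_le]; exact hz
  have key : ∀ g ∈ (L.Ψ.symm (GG {z})).1, Idm g → g = L.ψi k := by
    intro g hg hi
    rw [L.memi' _ hi] at hg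
    have h3 := (gen_group (h1.trans h2.symm) hg).1
    rw [dm_id (L.idm _ hi), h1] at h3
    rw [← h3, L.left _ hi]
  have hP : L.Ψ.symm (GG {z}) ≤ GG {L.ψi k} := by
    intro a ha
    have := h a (hPV ha) (key _ (sub_dm (L.Ψ.symm (GG {z})).2 ha) (id_dm a))
      (key _ (sub_rn (L.Ψ.symm (GG {z})).2 ha) (id_rn a))
    rw [this]; exact gen1 _
  rw [OrderIso.symm_apply_le, L.psi_id (L.idmi _ hk), L.right _ hk, GG1_le] at hP
  have : z ∈ genInv ({k} : Set T) := hP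
  rw [gen_id hk] at this
  exact this

/-- matching of nongroup elements -/
def M (x : S) (y : T) : Prop :=
  x ∈ NS S ∧ L.Ψ (GG {x}) = GG {y} ∧ L.ψ (dm x) = dm y ∧ L.ψ (rn x) = rn y

variable {L}

theorem M.ns {x : S} {y : T} (h : L.M x y) : y ∈ NS T := by
  rw [ns_iff, ← h.2.2.1, ← h.2.2.2]
  exact fun h' => h.1 (L.inj (id_dm _) (id_rn _) h')

theorem M.symm {x : S} {y : T} (h : L.M x y) : L.symm.M y x := by
  refine ⟨h.ns, ?_, ?_, ?_⟩
  · show L.Ψ.symm _ = _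
    rw [← h.2.1, OrderIso.symm_apply_apply]
  · show L.ψi _ = _
    rw [← h.2.2.1, L.left _ (id_dm _)]
  · show L.ψi _ = _
    rw [← h.2.2.2, L.left _ (id_rn _)]

theorem M.inv {x : S} {y : T} (h : L.M x y) : L.M x⁻¹ y⁻¹ := by
  refine ⟨ns_inv h.1, ?_, ?_, ?_⟩
  · have h1 : (GG {x⁻¹} : Sb S) = GG {x} := Subtype.ext (gen_inv x)
    have h2 : (GG {y⁻¹} : Sb T) = GG {y} := Subtype.ext (gen_inv y)
    rw [h1, h2, h.2.1]
  · rw [dm_inv, dm_inv, h.2.2.2]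
  · rw [rn_inv, rn_inv, h.2.2.1]

theorem M.mem_iff {x : S} {y : T} (h : L.M x y) {e : S} (he : Idm e) :
    e ∈ genInv ({x} : Set S) ↔ L.ψ e ∈ genInv ({y} : Set T) := by
  have := L.mem (GG {x}) e he
  rw [h.2.1] at this
  exact this

end LB

/-- order preserving version -/
structure LI (S T : Type*) [InverseSemigroup S] [InverseSemigroup T] extends LB S T where
  ord : ∀ e f, Idm e → Idm f → (idemLe e f ↔ idemLe (ψ e) (ψ f))

namespace LI

variable (L : LI S T)

/-- inverse -/
def symm : LI T S where
  toLB := L.toLB.symm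
  ord := by
    intro e f he hf
    show _ ↔ idemLe (L.ψi e) (L.ψi f)
    rw [L.ord _ _ (L.idmi _ he) (L.idmi _ hf), L.right _ he, L.right _ hf]

theorem psi_mul {e f : S} (he : Idm e) (hf : Idm f) : L.ψ (e * f) = L.ψ e * L.ψ f := by
  have hm := id_mulmul he hf
  have hm' := id_mulmul (L.idm e he) (L.idm f hf)
  apply le_anti (L.idm _ hm) hm'
  · exact le_mul ((L.ord _ _ hm he).1 (mul_le_l he hf)) ((L.ord _ _ hm hf).1 (mul_le_r he hf))
  · have hg := L.idmi _ hm'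
    have h1 := L.right _ hm'
    rw [← h1, ← L.ord _ _ hg hm]
    apply le_mul
    · rw [L.ord _ _ hg he, h1]; exact mul_le_l (L.idm e he) (L.idm f hf)
    · rw [L.ord _ _ hg hf, h1]; exact mul_le_r (L.idm e he) (L.idm f hf)

end LI

theorem par_prod {x : S} (h : ¬ idemLe (rn x) (dm x)) (h' : ¬ idemLe (dm x) (rn x)) {a b : S}
    (ha : a ∈ genInv ({x} : Set S)) (hb : b ∈ genInv ({x} : Set S)) (hab : a * b = x) :
    a = x ∨ b = x := by
  have h1 : idemLe (dm x) (dm a) := by rw [← hab]; exact dm_mul_le a b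
  have h2 : idemLe (rn x) (rn b) := by rw [← hab]; exact rn_mul_le a b
  have h3 : dm a = dm x := by
    rcases gen_top ha with h4 | h4
    · exact le_anti (id_dm _) (id_dm _) h4 h1
    · exact absurd (le_tr h1 h4) h'
  have hb' := (gen_sub _).2 _ hb
  have h5 : rn b = rn x := by
    rcases gen_top hb' with h4 | h4
    · rw [dm_inv] at h4; exact absurd (le_tr h2 h4) h
    · rw [dm_inv] at h4; exact le_anti (id_rn _) (id_rn _) h4 h2
  rcases rn_not_of_par h h' ha h3 with h6 | h6
  · right
    rw [← gen_inv] at hb'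
    rcases rn_not_of_par (x := x⁻¹) (by rwa [rn_inv, dm_inv]) (by rwa [rn_inv, dm_inv]) hb'
      (by rw [dm_inv, dm_inv, h5]) with h7 | h7
    · exfalso
      have h8 : b = rn x := by
        rw [← is_inv_inv b, h7, dm_inv, id_inv (id_rn x)]
      have h9 : Idm x := by rw [← hab, h6, h8]; exact id_mulmul (id_dm _) (id_rn _)
      apply h
      rw [dm_id h9, rn_id h9]; exact h9
    · rw [← is_inv_inv b, h7, is_inv_inv]
  · exact Or.inl h6

theorem K_par (L : LI S T) {x : S} (h : ¬ idemLe (rn x) (dm x)) (h' : ¬ idemLe (dm x) (rn x)) :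
    ∃ y, L.toLB.M x y := by
  have hx : x ∈ NS S := fun he => h (by
    have : dm x = rn x := he
    rw [this]; exact id_rn x)
  let W : Sb S := ⟨{w | w ∈ genInv ({x} : Set S) ∧ w ≠ x ∧ w ≠ x⁻¹}, by
    constructor
    · rintro a ⟨ha, ha1, ha2⟩ b ⟨hb, hb1, hb2⟩
      refine ⟨(gen_sub _).1 _ ha _ hb, fun hab => ?_, fun hab => ?_⟩
      · rcases par_prod h h' ha hb hab with h1 | h1
        · exact ha1 h1
        · exact hb1 h1
      · have h2 : b⁻¹ * a⁻¹ = x := by rw [← is_mul_inv, hab, is_inv_inv]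
        rcases par_prod h h' ((gen_sub _).2 _ hb) ((gen_sub _).2 _ ha) h2 with h1 | h1
        · exact hb2 (by rw [← h1, is_inv_inv])
        · exact ha2 (by rw [← h1, is_inv_inv])
    · rintro a ⟨ha, ha1, ha2⟩
      refine ⟨(gen_sub _).2 _ ha, fun h1 => ha2 (by rw [← h1, is_inv_inv]), fun h1 => ha1 ?_⟩
      rw [← is_inv_inv a, h1, is_inv_inv]⟩
  have hW : ¬ L.Ψ (GG {x}) ≤ L.Ψ W := by
    rw [OrderIso.le_iff_le]
    intro h1
    exact (h1 (gen1 x)).2.1 rfl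
  obtain ⟨y, hy, hyW⟩ := Set.not_subset.1 hW
  have hP1 : L.Ψ.symm (GG {y}) ≤ GG {x} := by
    rw [OrderIso.symm_apply_le, GG1_le]; exact hy
  have hP2 : ¬ L.Ψ.symm (GG {y}) ≤ W := by
    rw [OrderIso.symm_apply_le, GG1_le]; exact hyW
  obtain ⟨p, hp, hpW⟩ := Set.not_subset.1 hP2
  have hxP : x ∈ (L.Ψ.symm (GG {y})).1 := by
    by_cases h1 : p = x
    · rwa [← h1]
    · by_cases h2 : p = x⁻¹
      · have := (L.Ψ.symm (GG {y})).2.2 _ hp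
        rwa [h2, is_inv_inv] at this
      · exact absurd ⟨hP1 hp, h1, h2⟩ hpW
  have hG : L.Ψ (GG {x}) = GG {y} := by
    apply le_antisymm
    · rw [← OrderIso.le_symm_apply, GG1_le]; exact hxP
    · rw [GG1_le]; exact hy
  have up : ∀ g ∈ genInv ({x} : Set S), Idm g → idemLe (L.ψ g) (dm y) ∨ idemLe (L.ψ g) (rn y) := by
    intro g hg hi
    have h1 := (L.mem (GG {x}) g hi).1 hg
    rw [hG] at h1
    have h2 := gen_top h1
    rwa [dm_id (L.idm _ hi)] at h2
  have dn : ∀ g ∈ genInv ({y} : Set T), Idm g →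
      idemLe g (L.ψ (dm x)) ∨ idemLe g (L.ψ (rn x)) := by
    intro g hg hi
    have h1 : g ∈ (L.Ψ (GG {x})).1 := by rw [hG]; exact hg
    rw [L.memi _ hi] at h1
    have h2 := gen_top h1
    rw [dm_id (L.idmi _ hi), L.ord _ _ (L.idmi _ hi) (id_dm _),
      L.ord _ _ (L.idmi _ hi) (id_rn _), L.right _ hi] at h2
    exact h2
  have u1 := up _ (sub_dm (gen_sub _) (gen1 x)) (id_dm x)
  have u2 := up _ (sub_rn (gen_sub _) (gen1 x)) (id_rn x)
  have d1 := dn _ (sub_dm (gen_sub _) (gen1 y)) (id_dm y)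
  have d2 := dn _ (sub_rn (gen_sub _) (gen1 y)) (id_rn y)
  rw [L.ord _ _ (id_rn _) (id_dm _)] at h
  rw [L.ord _ _ (id_dm _) (id_rn _)] at h'
  have i1 := L.idm _ (id_dm x)
  have i2 := L.idm _ (id_rn x)
  have i3 := id_dm y
  have i4 := id_rn y
  have fin : (L.ψ (dm x) = dm y ∧ L.ψ (rn x) = rn y) ∨ (L.ψ (dm x) = rn y ∧ L.ψ (rn x) = dm y) := by
    rcases u1 with u1 | u1
    · have e1 : L.ψ (dm x) = dm y :=
        le_anti i1 i3 u1 (d1.resolve_right fun h2 => h' (le_tr u1 h2))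
      left; refine ⟨e1, ?_⟩
      have u3 := u2.resolve_left (fun h2 => h (by rw [e1]; exact h2))
      exact le_anti i2 i4 u3 (d2.resolve_left fun h2 => h (le_tr u3 h2))
    · have e1 : L.ψ (dm x) = rn y :=
        le_anti i1 i4 u1 (d2.resolve_right fun h2 => h' (le_tr u1 h2))
      right; refine ⟨e1, ?_⟩
      have u3 := u2.resolve_right (fun h2 => h (by rw [e1]; exact h2))
      exact le_anti i2 i3 u3 (d1.resolve_left fun h2 => h (le_tr u3 h2))
  rcases fin with ⟨f1, f2⟩ | ⟨f1, f2⟩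
  · exact ⟨y, hx, hG, f1, f2⟩
  · refine ⟨y⁻¹, hx, ?_, by rw [dm_inv, f1], by rw [rn_inv, f2]⟩
    rw [hG]; exact Subtype.ext (gen_inv y).symm

end Lat
section Bic

variable {S T : Type*} [InverseSemigroup S] [InverseSemigroup T]

/-- `t` is an arrow from `i` to `j` -/
def Ar (U : Set S) (ε : ℕ → S) (t : S) (i j : ℕ) : Prop := t ∈ U ∧ dm t = ε i ∧ rn t = ε j

theorem Ar.mul {U : Set S} {ε : ℕ → S} (h : Om U ε) {a b : S} {i j k l m n : ℕ} (ha : Ar U ε a i j)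
    (hb : Ar U ε b k l) (hm : m = i + (max j k - j)) (hn : n = l + (max j k - k)) :
    Ar U ε (a * b) m n := by
  subst hm; subst hn
  exact ⟨h.sub.1 _ ha.1 _ hb.1, h.dmm ha.1 ha.2.1 ha.2.2 hb.2.1 hb.2.2,
    h.rnm hb.1 ha.2.1 ha.2.2 hb.2.1 hb.2.2⟩

theorem Ar.inv {U : Set S} {ε : ℕ → S} (h : Om U ε) {a : S} {i j : ℕ} (ha : Ar U ε a i j) :
    Ar U ε a⁻¹ j i :=
  ⟨h.sub.2 _ ha.1, by rw [dm_inv, ha.2.2], by rw [rn_inv, ha.2.1]⟩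

theorem Om.ar {U : Set S} {ε : ℕ → S} (h : Om U ε) {a : S} (ha : a ∈ U) : ∃ i j, Ar U ε a i j := by
  obtain ⟨⟨i, hi⟩, j, hj⟩ := h.ex ha
  exact ⟨i, j, ha, hi, hj⟩

theorem Om.ar0 {U : Set S} {ε : ℕ → S} (h : Om U ε) (i : ℕ) : Ar U ε (ε i) i i :=
  ⟨h.mem i, dm_id (h.idm i), rn_id (h.idm i)⟩

theorem ar_pow {U : Set S} {ε : ℕ → S} (h : Om U ε) {z : S} {d : ℕ} (hz : Ar U ε z 0 d) (k : ℕ) :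
    ∃ u, (u = ε 0 ∨ u ∈ genInv ({z} : Set S)) ∧ Ar U ε u 0 (k * d) := by
  induction k with
  | zero => exact ⟨ε 0, Or.inl rfl, by simpa using h.ar0 0⟩
  | succ k ih =>
    obtain ⟨u, hu, hu'⟩ := ih
    have h1 : Ar U ε (u * z) 0 ((k + 1) * d) := by
      refine hu'.mul h hz (by simp) ?_
      rw [Nat.max_zero, Nat.sub_zero, Nat.add_mul, Nat.one_mul, Nat.add_comm]
    refine ⟨u * z, Or.inr ?_, h1⟩
    rcases hu with hu | hu
    · rw [hu, ← hz.2.1, dm_self]; exact gen1 z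
    · exact (gen_sub _).1 _ hu _ (gen1 z)

/-- generation by a unit step -/
theorem om_gen {U : Set S} {ε : ℕ → S} (h : Om U ε) (hc : ∀ t ∈ U, dm t = rn t → Idm t) {z : S}
    (hz : Ar U ε z 0 1) : genInv ({z} : Set S) = U := by
  apply Set.Subset.antisymm (gen1_le h.sub hz.1)
  have hp : ∀ k, ∃ u, u ∈ genInv ({z} : Set S) ∧ Ar U ε u 0 k := by
    intro k
    obtain ⟨u, hu, hu'⟩ := ar_pow h hz k
    refine ⟨u, ?_, by simpa using hu'⟩
    rcases hu with hu | hu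
    · rw [hu, ← hz.2.1]; exact sub_dm (gen_sub _) (gen1 z)
    · exact hu
  intro t ht
  obtain ⟨i, j, hij⟩ := h.ar ht
  obtain ⟨u, hu, hu'⟩ := hp i
  obtain ⟨v, hv, hv'⟩ := hp j
  have h1 : Ar U ε (u * t) 0 j := hu'.mul h hij (by simp) (by simp)
  have h2 : Ar U ε (u * t * v⁻¹) 0 0 := h1.mul h (hv'.inv h) (by simp) (by simp)
  have h3 : u * t * v⁻¹ = ε 0 := by
    have := hc _ h2.1 (h2.2.1.trans h2.2.2.symm)
    rw [← dm_id this, h2.2.1]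
  have h4 : t = u⁻¹ * (u * t * v⁻¹) * v := by
    have e1 : t = rn u * t * rn v := by
      rw [hu'.2.2, hv'.2.2, ← hij.2.1, ← hij.2.2, dm_self, rn_self]
    calc t = rn u * t * rn v := e1
      _ = _ := by simp only [rn, mul_assoc]
  rw [h4, h3, ← hz.2.1]
  exact (gen_sub _).1 _ ((gen_sub _).1 _ ((gen_sub _).2 _ hu) _ (sub_dm (gen_sub _) (gen1 z))) _ hv

theorem om_img (L : LI S T) {x : S} (h : idemLe (rn x) (dm x)) (hne : dm x ≠ rn x) :
    Om (L.Ψ (GG {x})).1 (fun i => L.ψ (bep x i)) := by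
  have ho := om_bi h hne
  refine ⟨(L.Ψ (GG {x})).2, fun i => L.idm _ (ho.idm i), fun i => (L.mem _ _ (ho.idm i)).1 (ho.mem i),
    fun i j => ?_, fun i j hij => ho.inj (L.inj (ho.idm i) (ho.idm j) hij), fun w hw hi => ?_⟩
  · rw [← L.psi_mul (ho.idm i) (ho.idm j), ho.mul]
  · rw [L.memi _ hi] at hw
    obtain ⟨i, hw⟩ := ho.all _ hw (L.idmi _ hi)
    exact ⟨i, by rw [← hw, L.right _ hi]⟩

theorem comb_img (L : LB S T) {x : S} (h : idemLe (rn x) (dm x)) (hne : dm x ≠ rn x) :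
    ∀ t ∈ (L.Ψ (GG {x})).1, dm t = rn t → Idm t := by
  intro t ht hg
  have := L.group_lem ht rfl hg.symm (by
    intro a ha h1 h2
    have := bi_comb h hne ha (h1.trans h2.symm)
    rw [← h1, dm_id this])
  rw [this]; exact id_dm t

theorem K_bi (L : LI S T) {x : S} (h : idemLe (rn x) (dm x)) (hne : dm x ≠ rn x) :
    ∃ y, L.toLB.M x y := by
  have ho := om_bi h hne
  have ho' := om_img L h hne
  have hcb := comb_img L.toLB h hne
  set U := (L.Ψ (GG {x})).1 with hU
  set ε := bep x with hε
  set ε' : ℕ → T := fun i => L.ψ (ε i) with hε'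
  -- pulling back idempotents
  have pull : ∀ (t : T) (p : ℕ), ε p ∈ (L.Ψ.symm (GG {t})).1 → ε' p ∈ genInv ({t} : Set T) :=
    fun t p hp => (L.memi' _ (ho.idm p)).1 hp
  have sub : ∀ t ∈ U, L.Ψ.symm (GG {t}) ≤ GG {x} := by
    intro t ht
    rw [OrderIso.symm_apply_le, GG1_le]; exact ht
  -- step 1
  have s1 : ∃ j, 1 ≤ j ∧ ∃ t, Ar U ε' t 0 j := by
    let W : Sb S := ⟨{w | w ∈ genInv ({x} : Set S) ∧ (w = ε 0 ∨ (dm w ≠ ε 0 ∧ rn w ≠ ε 0))}, by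
      have e0 : ε 0 = dm x := bep_zero x
      constructor
      · rintro a ⟨ha, ha'⟩ b ⟨hb, hb'⟩
        refine ⟨(gen_sub _).1 _ ha _ hb, ?_⟩
        rcases ha' with ha' | ha'
        · rw [ha', dm_mul_of_le (ho.idm 0) (by rw [e0]; exact gen_dm_le h hb)]
          exact hb'
        · rcases hb' with hb' | hb'
          · rw [hb', mul_of_rn_le (by rw [e0, ← dm_inv]; exact gen_dm_le h ((gen_sub _).2 _ ha))]
            exact Or.inr ha'
          · right
            constructor
            · intro h1
              apply ha'.1
              have h2 := dm_mul_le a b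
              rw [h1] at h2
              exact le_anti (id_dm _) (ho.idm 0) (by rw [e0]; exact gen_dm_le h ha) h2
            · intro h1
              apply hb'.2
              have h2 := rn_mul_le a b
              rw [h1] at h2
              exact le_anti (id_rn _) (ho.idm 0)
                (by rw [e0, ← dm_inv]; exact gen_dm_le h ((gen_sub _).2 _ hb)) h2
      · rintro a ⟨ha, ha'⟩
        refine ⟨(gen_sub _).2 _ ha, ?_⟩
        rcases ha' with ha' | ha'
        · left; rw [ha', id_inv (ho.idm 0)]
        · right; rw [dm_inv, rn_inv]; exact ⟨ha'.2, ha'.1⟩⟩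
    have hW : ¬ L.Ψ (GG {x}) ≤ L.Ψ W := by
      rw [OrderIso.le_iff_le]
      intro h1
      rcases (h1 (gen1 x)).2 with h2 | h2
      · have : Idm x := by rw [h2]; exact ho.idm 0
        exact hne ((dm_id this).trans (rn_id this).symm)
      · exact h2.1 (bep_zero x).symm
    obtain ⟨t, ht, htW⟩ := Set.not_subset.1 hW
    obtain ⟨i, j, hij⟩ := ho'.ar ht
    by_cases hi : i = 0
    · subst hi
      by_cases hj : j = 0
      · subst hj
        exfalso
        apply htW
        have h1 := hcb t ht (hij.2.1.trans hij.2.2.symm)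
        rw [← dm_id h1, hij.2.1]
        exact (L.mem W _ (ho.idm 0)).1 ⟨ho.mem 0, Or.inl rfl⟩
      · exact ⟨j, Nat.one_le_iff_ne_zero.2 hj, t, hij⟩
    · by_cases hj : j = 0
      · subst hj
        exact ⟨i, Nat.one_le_iff_ne_zero.2 hi, t⁻¹, hij.inv ho'⟩
      · exfalso
        apply htW
        have : GG {t} ≤ L.Ψ W := by
          rw [← OrderIso.symm_apply_le]
          have key : ε 0 ∉ (L.Ψ.symm (GG {t})).1 := by
            intro h1
            have h2 := gen_top (pull t 0 h1)
            rw [dm_id (ho'.idm 0), hij.2.1, hij.2.2, ho'.le_iff, ho'.le_iff] at h2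
            omega
          intro a ha
          refine ⟨sub t ht ha, Or.inr ⟨fun h1 => key ?_, fun h1 => key ?_⟩⟩
          · rw [← h1]; exact sub_dm (Subtype.property _) ha
          · rw [← h1]; exact sub_rn (Subtype.property _) ha
        exact GG1_le.1 this
  classical
  obtain ⟨hd1, z, hz⟩ := Nat.find_spec s1
  have hmin : ∀ j, 1 ≤ j → (∃ t, Ar U ε' t 0 j) → Nat.find s1 ≤ j :=
    fun j h1 h2 => Nat.find_min' s1 ⟨h1, h2⟩
  generalize Nat.find s1 = d at hd1 hz hmin
  have s3 : ∀ j t, Ar U ε' t 0 j → d ∣ j := by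
    intro j
    induction j using Nat.strong_induction_on with
    | _ j ih =>
      intro t ht
      by_cases hj : j = 0
      · rw [hj]; exact dvd_zero d
      · have h1 := hmin j (Nat.one_le_iff_ne_zero.2 hj) ⟨t, ht⟩
        have h2 : Ar U ε' (t * z⁻¹) 0 (j - d) :=
          ht.mul ho' (hz.inv ho') (by omega) (by omega)
        have h3 := ih (j - d) (by omega) _ h2
        have h4 := (Nat.dvd_add h3 (dvd_refl d))
        rwa [Nat.sub_add_cancel h1] at h4
  have s4 : ∀ t i j, Ar U ε' t i j → (d : ℤ) ∣ (i : ℤ) - j := by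
    intro t i j ht
    obtain ⟨u, -, hu⟩ := ar_pow ho' hz i
    have hle : i ≤ i * d := Nat.le_mul_of_pos_right i hd1
    have h1 : Ar U ε' (u * t) 0 (j + (i * d - i)) :=
      hu.mul ho' ht (by rw [max_eq_left hle]; omega) (by rw [max_eq_left hle])
    have h2 := s3 _ _ h1
    have h3 : (d : ℤ) ∣ ((j + (i * d - i) : ℕ) : ℤ) := by exact_mod_cast h2
    rw [Nat.cast_add, Nat.cast_sub hle, Nat.cast_mul] at h3
    have h4 : (i : ℤ) - j = i * d - (j + (i * d - i)) := by ring
    rw [h4]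
    exact dvd_sub (Dvd.intro_left _ rfl) h3
  -- closed sets modulo d
  have s5 : d = 1 := by
    let V : Sb S := ⟨{w | ∃ i j, Ar (genInv ({x} : Set S)) ε w i j ∧ (d : ℤ) ∣ (i : ℤ) - j}, by
      constructor
      · rintro a ⟨i, j, ha, hij⟩ b ⟨k, l, hb, hkl⟩
        refine ⟨_, _, ha.mul ho hb rfl rfl, ?_⟩
        have e1 : ((i + (max j k - j) : ℕ) : ℤ) - ((l + (max j k - k) : ℕ) : ℤ) =
            ((i : ℤ) - j) + ((k : ℤ) - l) := by omega
        rw [e1]; exact dvd_add hij hkl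
      · rintro a ⟨i, j, ha, hij⟩
        exact ⟨j, i, ha.inv ho, by rw [← dvd_neg]; simpa using hij⟩⟩
    by_cases hxV : x ∈ V.1
    · obtain ⟨i, j, ha, hij⟩ := hxV
      have h1 : i = 0 := ho.inj (by rw [← ha.2.1]; exact (bep_zero x).symm)
      have h2 : j = 1 := ho.inj (by rw [← ha.2.2]; exact (bep_one x).symm)
      subst h1; subst h2
      have h3 : (d : ℤ) ∣ 1 := by rw [← dvd_neg]; simpa using hij
      have h4 : d ∣ 1 := by exact_mod_cast h3
      exact Nat.dvd_one.1 h4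
    · exfalso
      have hV : ¬ L.Ψ (GG {x}) ≤ L.Ψ V := by
        rw [OrderIso.le_iff_le, GG1_le]; exact hxV
      obtain ⟨t, ht, htV⟩ := Set.not_subset.1 hV
      obtain ⟨i, j, hij⟩ := ho'.ar ht
      have h1 := s4 _ _ _ hij
      have hQ : IsInvSub {w | ∃ k l, Ar U ε' w k l ∧ (d : ℤ) ∣ (i : ℤ) - k ∧ (d : ℤ) ∣ (i : ℤ) - l} := by
        constructor
        · rintro a ⟨p, q, ha, hp, hq⟩ b ⟨k, l, hb, hk, hl⟩
          refine ⟨_, _, ha.mul ho' hb rfl rfl, ?_, ?_⟩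
          · rcases le_total q k with hqk | hqk
            · have e1 : (i : ℤ) - ((p + (max q k - q) : ℕ) : ℤ) =
                ((i : ℤ) - p) + ((i : ℤ) - k) - ((i : ℤ) - q) := by omega
              rw [e1]; exact dvd_sub (dvd_add hp hk) hq
            · have e1 : (i : ℤ) - ((p + (max q k - q) : ℕ) : ℤ) = ((i : ℤ) - p) := by omega
              rw [e1]; exact hp
          · rcases le_total q k with hqk | hqk
            · have e1 : (i : ℤ) - ((l + (max q k - k) : ℕ) : ℤ) = ((i : ℤ) - l) := by omega
              rw [e1]; exact hl
            · have e1 : (i : ℤ) - ((l + (max q k - k) : ℕ) : ℤ) =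
                ((i : ℤ) - l) + ((i : ℤ) - q) - ((i : ℤ) - k) := by omega
              rw [e1]; exact dvd_sub (dvd_add hl hq) hk
        · rintro a ⟨p, q, ha, hp, hq⟩
          exact ⟨q, p, ha.inv ho', hq, hp⟩
      have hQt := gen1_le hQ (x := t) ⟨i, j, hij, by simp, h1⟩
      have hQp : ∀ p, ε p ∈ (L.Ψ.symm (GG {t})).1 → (d : ℤ) ∣ (i : ℤ) - p := by
        intro p hp
        obtain ⟨k, l, hkl, h2, -⟩ := hQt (pull t p hp)
        have := hkl.2.1
        rw [dm_id (ho'.idm p)] at this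
        rwa [ho'.inj this]
      apply htV
      have : GG {t} ≤ L.Ψ V := by
        rw [← OrderIso.symm_apply_le]
        intro a ha
        obtain ⟨p, q, hpq⟩ := ho.ar (sub t ht ha)
        refine ⟨p, q, hpq, ?_⟩
        have h2 := hQp p (by rw [← hpq.2.1]; exact sub_dm (Subtype.property _) ha)
        have h3 := hQp q (by rw [← hpq.2.2]; exact sub_rn (Subtype.property _) ha)
        have e1 : (p : ℤ) - q = ((i : ℤ) - q) - ((i : ℤ) - p) := by ring
        rw [e1]; exact dvd_sub h3 h2
      exact GG1_le.1 this
  subst s5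
  refine ⟨z, hne, ?_, ?_, ?_⟩
  · exact Subtype.ext (om_gen ho' hcb hz).symm
  · rw [hz.2.1, ← bep_zero x]
  · rw [hz.2.2, ← bep_one x]

theorem K_lem (L : LI S T) {x : S} (hx : x ∈ NS S) : ∃ y, L.toLB.M x y := by
  by_cases h : idemLe (rn x) (dm x)
  · exact K_bi L h hx
  · by_cases h' : idemLe (dm x) (rn x)
    · obtain ⟨y, hy⟩ := K_bi L (x := x⁻¹) (by rwa [rn_inv, dm_inv]) (ns_inv hx)
      exact ⟨y⁻¹, by simpa only [is_inv_inv] using hy.inv⟩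
    · exact K_par L h h'

end Bic
section ClaimC

variable {S T : Type*} [InverseSemigroup S] [InverseSemigroup T]

theorem K_symm (L : LI S T) {z : T} (hz : z ∈ NS T) : ∃ w, L.toLB.M w z := by
  obtain ⟨w, hw⟩ := K_lem L.symm hz
  exact ⟨w, hw.symm⟩

theorem mem_of {L : LB S T} {x w c : S} {y z : T} (h : L.M x y) (hc : Idm c) (hw : L.M w z)
    (hz : z ∈ genInv ({y, L.ψ c} : Set T)) : w ∈ genInv ({x, c} : Set S) := by
  have : (GG {w} : Sb S) ≤ GG {x, c} := by
    rw [← OrderIso.le_iff_le L.Ψ, hw.2.1, L.psi_two h.2.1 hc, GG1_le]; exact hz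
  exact GG1_le.1 this

theorem mem_of1 {L : LB S T} {x w : S} {y z : T} (h : L.M x y) (hw : L.M w z)
    (hw' : w ∈ genInv ({x} : Set S)) : z ∈ genInv ({y} : Set T) := by
  have : (GG {z} : Sb T) ≤ GG {y} := by
    rw [← hw.2.1, ← h.2.1, OrderIso.le_iff_le, GG1_le]; exact hw'
  exact GG1_le.1 this

theorem cx_mem (c x : S) : c * x ∈ genInv ({x, c} : Set S) :=
  (gen_sub _).1 _ (gen_self _ (by simp)) _ (gen_self _ (by simp))

theorem not_ns_id {e : S} (h : Idm e) : e ∉ NS S := fun h' => h' ((dm_id h).trans (rn_id h).symm)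

theorem dm_cx {c x : S} (hc : Idm c) (h : idemLe c (dm x)) : dm (c * x) = c := by
  rw [dm_idmul hc]; exact h

theorem psi_le_dm (L : LI S T) {x c : S} {y : T} (hM : L.toLB.M x y) (hc : Idm c) :
    idemLe c (dm x) ↔ idemLe (L.ψ c) (dm y) := by
  rw [L.ord _ _ hc (id_dm x), hM.2.2.1]
theorem psi_le_rn (L : LI S T) {x c : S} {y : T} (hM : L.toLB.M x y) (hc : Idm c) :
    idemLe c (rn x) ↔ idemLe (L.ψ c) (rn y) := by
  rw [L.ord _ _ hc (id_rn x), hM.2.2.2]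

/-- idempotent restriction -/
theorem C_id (L : LI S T) {x c : S} {y : T} (hM : L.toLB.M x y) (hc : Idm c)
    (hcx : idemLe c (dm x)) (hi : Idm (c * x)) : L.ψ c * y = L.ψ c := by
  have h1 : c * x = c := by rw [← dm_id hi, dm_cx hc hcx]
  have key : ∀ w ∈ genInv ({x, c} : Set S), c * w = c := by
    apply gen_ind
    · rintro w (rfl | rfl)
      · exact h1
      · exact hc
    · rintro w (rfl | rfl)
      · calc c * w⁻¹ = c * w * w⁻¹ := by rw [h1]
          _ = c * dm w := by rw [dm, mul_assoc]
          _ = c := hcx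
      · rw [id_inv hc]; exact hc
    · intro a b ha hb
      rw [← mul_assoc, ha, hb]
  have key' : ∀ w ∈ genInv ({x, c} : Set S), dm w = c → w = c := by
    intro w hw hd
    rw [← key w hw, ← hd, dm_self]
  have hc' := L.idm _ hc
  have hd : dm (L.ψ c * y) = L.ψ c := dm_cx hc' ((psi_le_dm L hM hc).1 hcx)
  have hm := cx_mem (L.ψ c) y
  by_cases hn : L.ψ c * y ∈ NS T
  · exfalso
    obtain ⟨w, hw⟩ := K_symm L hn
    have h2 := key' w (mem_of hM hc hw hm) (L.inj (id_dm _) hc (by rw [hw.2.2.1, hd]))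
    have h3 := hw.1
    rw [h2] at h3
    exact not_ns_id hc h3
  · have hg : dm (L.ψ c * y) = rn (L.ψ c * y) := not_not.1 hn
    refine L.group_lem (V := GG {x, c}) ?_ hd (hg.symm.trans hd) ?_
    · rw [L.psi_two hM.2.1 hc]; exact hm
    · rw [L.left _ hc]
      intro a ha h2 _
      exact key' a ha h2

theorem lemN (L : LI S T) {x c : S} {y : T} (hM : L.toLB.M x y) (hc : Idm c)
    (hcx : idemLe c (dm x)) (hcr : ¬ idemLe c (rn x))
    (hh : L.ψ (rn (x * x)) = rn (y * y) ∨ ¬ idemLe c (dm (x * x))) :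
    L.toLB.M (c * x) (L.ψ c * y) := by
  have hc' := L.idm _ hc
  have hcx' := (psi_le_dm L hM hc).1 hcx
  have hcr' : ¬ idemLe (L.ψ c) (rn y) := fun h => hcr ((psi_le_rn L hM hc).2 h)
  have hd : dm (L.ψ c * y) = L.ψ c := dm_cx hc' hcx'
  have hr : rn (L.ψ c * y) = cj y (L.ψ c) := rn_idmul hc' y
  have hn : L.ψ c * y ∈ NS T := by
    rw [ns_iff, hd, hr]
    intro h
    apply hcr'
    rw [h]; exact cj_le hc' y
  obtain ⟨w, hw⟩ := K_symm L hn
  have hdw : dm w = c := L.inj (id_dm _) hc (by rw [hw.2.2.1, hd])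
  obtain ⟨k, hk⟩ := path_lemma hc hcr (mem_of hM hc hw (cx_mem _ _)) hdw
  match k, hk with
  | 0, hk =>
    have h3 := hw.1
    rw [hk] at h3
    exact absurd h3 (not_ns_id hc)
  | 1, hk =>
    have : w = c * x := hk
    rw [← this]; exact hw
  | k + 2, hk =>
    exfalso
    rcases hh with hh | hh
    · have h1 := qp_two_rn c x k
      rw [← hk, L.ord _ _ (id_rn _) (id_rn _), hw.2.2.2, hh, hr] at h1
      exact not_le_rn_sq hc' hcx' hcr' h1
    · exact hh (qp_two_dm hc hcx k (by rw [← hk, hdw]))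

theorem M_flip (L : LI S T) {x c : S} {y : T} (hc : Idm c) (hcx : idemLe c (dm x))
    (h : L.toLB.M (cj x c * x⁻¹) (L.ψ (cj x c) * y⁻¹)) : L.toLB.M (c * x) (L.ψ c * y) := by
  have hi := id_cj hc x
  have hi' := L.idm _ hi
  have h1 := h.inv
  rw [is_mul_inv, is_mul_inv, id_inv hi, id_inv hi', is_inv_inv, is_inv_inv, ← mul_cj hc] at h1
  have h2 : dm (y * L.ψ (cj x c)) = L.ψ c := by rw [← h1.2.2.1, dm_cx hc hcx]
  have h3 : y * L.ψ (cj x c) = L.ψ c * y := by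
    rw [← h2, dm, is_mul_inv, id_inv hi']
    calc y * L.ψ (cj x c) = y * (rn y * L.ψ (cj x c)) * L.ψ (cj x c) := by
          rw [← mul_assoc y, rn_self, mul_assoc, hi']
      _ = y * (L.ψ (cj x c) * rn y) * L.ψ (cj x c) := by rw [id_comm (id_rn y) hi']
      _ = y * L.ψ (cj x c) * (rn y * L.ψ (cj x c)) := by simp only [mul_assoc]
      _ = y * L.ψ (cj x c) * (L.ψ (cj x c) * rn y) := by rw [id_comm (id_rn y) hi']
      _ = _ := by simp only [rn, mul_assoc]
  rwa [h3] at h1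

theorem C_bi (L : LI S T) {x c : S} {y : T} (hM : L.toLB.M x y) (h : idemLe (rn x) (dm x))
    (hc : Idm c) (hcx : idemLe c (dm x)) (hh : ¬ idemLe c (rn x) ∨ c = rn x) :
    L.toLB.M (c * x) (L.ψ c * y) := by
  have ho := om_bi h hM.1
  have ho' := om_img L h hM.1
  have hy : y ∈ (L.Ψ (GG {x})).1 := by rw [hM.2.1]; exact gen1 y
  have hsq : L.ψ (rn (x * x)) = rn (y * y) := by
    have := ho'.shift hy (p := 0) (q := 1) (by simp only [bep_zero]; exact hM.2.2.1.symm)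
      (by simp only [bep_one]; exact hM.2.2.2.symm) 1
    simp only [zero_add, bep_one, hM.2.2.2] at this
    rw [rn_mul y y, this, ← bep_two]
  rcases hh with hh | rfl
  · exact lemN L hM hc hcx hh (Or.inl hsq)
  · have hrx : rn (rn x * x) = bep x 2 := by rw [rn_idmul hc, ← bep_one, ← bep_succ]
    have hn : rn x * x ∈ NS S := by
      rw [ns_iff, dm_cx hc hcx, hrx, ← bep_one]
      exact (bep_ne h hM.1 1).symm
    obtain ⟨u, hu⟩ := K_lem L hn
    have h1 : u ∈ genInv ({y} : Set T) := mem_of1 hM hu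
      ((gen_sub _).1 _ (sub_rn (gen_sub _) (gen1 x)) _ (gen1 x))
    have hcb := comb_img L.toLB h hM.1
    rw [hM.2.1] at hcb
    have h2 : u = L.ψ (rn x) * y := by
      refine comb_eq (gen_sub _) hcb h1 ?_ ?_ ?_
      · rw [hM.2.2.2]; exact (gen_sub _).1 _ (sub_rn (gen_sub _) (gen1 y)) _ (gen1 y)
      · rw [← hu.2.2.1, dm_cx hc hcx, dm_cx (L.idm _ hc) ((psi_le_dm L hM hc).1 hcx)]
      · rw [← hu.2.2.2, hrx, bep_two, hsq, rn_idmul (L.idm _ hc), hM.2.2.2, rn_mul]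
    rw [← h2]; exact hu

/-- the small idempotents -/
def Sm (x g : S) : Prop := idemLe g (dm (x * x)) ∨ idemLe g (dm x * rn x) ∨ idemLe g (rn (x * x))

theorem cj_dmsq (x : S) : cj x (dm (x * x)) = dm x * rn x := by
  rw [dm_mul, cj_back' (id_dm x)]

theorem Sm_inv {x g : S} (h : Sm x⁻¹ g) : Sm x g := by
  unfold Sm at *
  rw [dm_inv, rn_inv, ← is_mul_inv, dm_inv, rn_inv, id_comm (id_rn x) (id_dm x)] at h
  tauto

theorem Sm_step {x g : S} (hg : Idm g) (h : g = dm x ∨ g = rn x ∨ Sm x g) :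
    cj x g = dm x ∨ cj x g = rn x ∨ Sm x (cj x g) := by
  rcases h with rfl | rfl | h | h | h
  · rw [cj_dm]; exact Or.inr (Or.inl rfl)
  · rw [← rn_mul]; exact Or.inr (Or.inr (Or.inr (Or.inr (id_rn _))))
  · right; right; right; left
    have := cj_mono hg (id_dm _) x h
    rwa [cj_dmsq] at this
  · right; right; right; right
    have := cj_mono hg (id_rn x) x (le_tr h (mul_le_r (id_dm x) (id_rn x)))
    rwa [← rn_mul] at this
  · right; right; right; right
    have := cj_mono hg (id_rn x) x (le_tr h (rn_mul_le x x))
    rwa [← rn_mul] at this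

theorem idem_class {x g : S} (hg : g ∈ genInv ({x} : Set S)) (hi : Idm g) :
    g = dm x ∨ g = rn x ∨ Sm x g := by
  have key : ∀ w ∈ genInv ({x} : Set S), ∀ g, Idm g → (g = dm x ∨ g = rn x ∨ Sm x g) →
      (cj w g = dm x ∨ cj w g = rn x ∨ Sm x (cj w g)) := by
    apply gen_ind
    · rintro _ rfl g hg h
      exact Sm_step hg h
    · rintro w rfl g hg h
      have := Sm_step (x := w⁻¹) hg (by
        rw [dm_inv, rn_inv]
        rcases h with h | h | h
        · tauto
        · tauto
        · exact Or.inr (Or.inr (Sm_inv (by rwa [is_inv_inv]))))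
      rw [dm_inv, rn_inv] at this
      rcases this with h | h | h
      · tauto
      · tauto
      · exact Or.inr (Or.inr (Sm_inv h))
    · intro a b ha hb g hg h
      rw [← cj_cj]
      exact hb _ (id_cj hg a) (ha g hg h)
  have h2 := gen_top hg
  rw [dm_id hi] at h2
  have e1 : ∀ f, Idm f → idemLe g f → cj g f = g := by
    intro f _ hgf
    rw [cj, id_inv hi, hgf, hi]
  rcases h2 with h2 | h2
  · have := key g hg (dm x) (id_dm x) (Or.inl rfl)
    rwa [e1 _ (id_dm x) h2] at this
  · have := key g hg (rn x) (id_rn x) (Or.inr (Or.inl rfl))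
    rwa [e1 _ (id_rn x) h2] at this

theorem dmsq_le (L : LI S T) {x : S} {y : T} (hM : L.toLB.M x y) (h : ¬ idemLe (rn x) (dm x))
    (hab : ¬ idemLe (dm (x * x)) (dm x * rn x)) : idemLe (L.ψ (dm (x * x))) (dm (y * y)) := by
  have hi := id_dm (x * x)
  have hi' := L.idm _ hi
  have hmem : dm (x * x) ∈ genInv ({x} : Set S) :=
    sub_dm (gen_sub _) ((gen_sub _).1 _ (gen1 x) _ (gen1 x))
  have hle : idemLe (dm (x * x)) (dm x) := dm_mul_le x x
  have hnr : ¬ idemLe (dm (x * x)) (rn x) := fun h1 => hab (le_mul hle h1)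
  rcases idem_class ((hM.mem_iff hi).1 hmem) hi' with h1 | h1 | h1 | h1 | h1
  · exfalso
    rw [← hM.2.2.1] at h1
    exact h (le_of_dm_mul (L.inj hi (id_dm _) h1))
  · exfalso
    rw [← hM.2.2.2] at h1
    apply hnr
    rw [L.inj hi (id_rn _) h1]; exact id_rn x
  · exact h1
  · exact absurd ((psi_le_rn L hM hi).2 (le_tr h1 (mul_le_r (id_dm _) (id_rn _)))) hnr
  · exact absurd ((psi_le_rn L hM hi).2 (le_tr h1 (rn_mul_le _ _))) hnr

theorem lemP (L : LI S T) {x : S} {y : T} (hM : L.toLB.M x y) (h : ¬ idemLe (rn x) (dm x))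
    (hab : ¬ idemLe (dm (x * x)) (dm x * rn x)) :
    L.toLB.M (dm (x * x) * x) (L.ψ (dm (x * x)) * y) := by
  have hi := id_dm (x * x)
  have hi' := L.idm _ hi
  have hle : idemLe (dm (x * x)) (dm x) := dm_mul_le x x
  have hnr : ¬ idemLe (dm (x * x)) (rn x) := fun h1 => hab (le_mul hle h1)
  have hle' := (psi_le_dm L hM hi).1 hle
  have hnr' : ¬ idemLe (L.ψ (dm (x * x))) (rn y) := fun h1 => hnr ((psi_le_rn L hM hi).2 h1)
  have q1 := dmsq_le L hM h hab
  have heq : L.ψ (dm (x * x)) = dm (y * y) := by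
    apply le_anti hi' (id_dm _) q1
    have q2 := dmsq_le L.symm hM.symm (x := y) (y := x)
      (by rwa [← hM.2.2.1, ← hM.2.2.2, ← L.ord _ _ (id_rn x) (id_dm x)])
      (fun h1 => hnr' (le_tr q1 (le_tr h1 (mul_le_r (id_dm _) (id_rn _)))))
    have q3 : idemLe (L.ψi (dm (y * y))) (dm (x * x)) := q2
    rwa [L.ord _ _ (L.idmi _ (id_dm _)) hi, L.right _ (id_dm _)] at q3
  have hr : rn (dm (x * x) * x) = dm x * rn x := by rw [rn_idmul hi, cj_dmsq]
  have hn : dm (x * x) * x ∈ NS S := by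
    rw [ns_iff, dm_cx hi hle, hr]
    intro h1
    exact hab (by rw [← h1]; exact hi)
  obtain ⟨u, hu⟩ := K_lem L hn
  have h1 : u ∈ genInv ({y} : Set T) := mem_of1 hM hu
    ((gen_sub _).1 _ (sub_dm (gen_sub _) ((gen_sub _).1 _ (gen1 x) _ (gen1 x))) _ (gen1 x))
  have h2 : u ∈ genInv ({y, L.ψ (dm (x * x))} : Set T) :=
    gen1_le (gen_sub _) (gen_self _ (by simp)) h1
  have hdu : dm u = L.ψ (dm (x * x)) := by rw [← hu.2.2.1, dm_cx hi hle]
  obtain ⟨k, hk⟩ := path_lemma hi' hnr' h2 hdu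
  match k, hk with
  | 0, hk =>
    have h3 := hu.ns
    rw [hk] at h3
    exact absurd h3 (not_ns_id hi')
  | 1, hk =>
    have : u = L.ψ (dm (x * x)) * y := hk
    rw [← this]; exact hu
  | k + 2, hk =>
    exfalso
    have h3 := qp_two_rn (L.ψ (dm (x * x))) y k
    rw [← hk, ← hu.2.2.2, hr, L.psi_mul (id_dm x) (id_rn x), hM.2.2.1, hM.2.2.2, ← cj_dmsq,
      ← heq] at h3
    exact not_le_rn_sq hi' hle' hnr' h3

theorem C_ns (L : LI S T) {x c : S} {y : T} (hM : L.toLB.M x y) (hc : Idm c) (hcov : XCov x c)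
    (hn : c * x ∈ NS S) : L.toLB.M (c * x) (L.ψ c * y) := by
  have hcx : idemLe c (dm x) := hcov.1.1
  have hmsq : dm (x * x) ∈ genInv ({x} : Set S) :=
    sub_dm (gen_sub _) ((gen_sub _).1 _ (gen1 x) _ (gen1 x))
  have cov : ∀ f ∈ genInv ({x} : Set S), Idm f → idemLe f (dm x) → f ≠ dm x → idemLe c f → c = f := by
    intro f hf hi h1 h2 h3
    by_contra h4
    exact hcov.2 f hf hi ⟨⟨h3, h4⟩, h1, h2⟩
  by_cases h : idemLe (rn x) (dm x)
  · refine C_bi L hM h hc hcx ?_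
    by_cases h1 : idemLe c (rn x)
    · right
      exact cov _ (sub_rn (gen_sub _) (gen1 x)) (id_rn x) h (Ne.symm hM.1) h1
    · exact Or.inl h1
  · have ha : idemLe c (dm (x * x)) → c = dm (x * x) :=
      cov _ hmsq (id_dm _) (dm_mul_le x x) (fun h1 => h (le_of_dm_mul h1))
    by_cases h' : idemLe (dm x) (rn x)
    · apply M_flip L hc hcx
      refine C_bi L hM.inv (by rwa [rn_inv, dm_inv]) (id_cj hc x)
        (by rw [dm_inv]; exact cj_le hc x) ?_
      rw [rn_inv]
      by_cases h1 : idemLe (cj x c) (dm x)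
      · right
        have h2 := cj_le_iff hc (id_dm x) x hcx h1
        rw [← dm_mul] at h2
        rw [ha h2, cj_dmsq]; exact h'
      · exact Or.inl h1
    · have hb : idemLe c (dm x * rn x) → c = dm x * rn x := by
        apply cov _ ((gen_sub _).1 _ (sub_dm (gen_sub _) (gen1 x)) _ (sub_rn (gen_sub _) (gen1 x)))
          (id_mulmul (id_dm _) (id_rn _)) (mul_le_l (id_dm _) (id_rn _))
        intro h1
        exact h' h1
      by_cases h1 : idemLe c (dm (x * x))
      · have e1 := ha h1
        by_cases h2 : idemLe c (dm x * rn x)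
        · exfalso
          have e2 := hb h2
          apply hn
          show dm (c * x) = rn (c * x)
          rw [dm_cx hc hcx, rn_idmul hc, e1, cj_dmsq, ← e2, e1]
        · subst e1
          exact lemP L hM h h2
      · by_cases h2 : idemLe c (dm x * rn x)
        · have e2 := hb h2
          apply M_flip L hc hcx
          have e3 : cj x c = dm (x⁻¹ * x⁻¹) := by
            rw [← is_mul_inv, dm_inv, rn_mul, e2, cj_res' (id_rn x)]
          rw [e3]
          apply lemP L hM.inv (by rwa [rn_inv, dm_inv])
          rw [← e3, dm_inv, rn_inv, id_comm (id_rn x) (id_dm x), ← cj_dmsq]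
          intro h3
          have h4 := cj_le_iff hc (id_cj (id_dm _) x) x hcx h3
          rw [cj_back (id_dm _)] at h4
          exact h1 (le_tr h4 (mul_le_l (id_dm _) (id_dm _)))
        · exact lemN L hM hc hcx (fun h3 => h2 (le_mul hcx h3)) (Or.inr h1)

end ClaimC
section MainIso

variable {S T : Type*} [InverseSemigroup S] [InverseSemigroup T]

theorem cj_restrict {c g : S} (hc : Idm c) (hg : Idm g) (x : S) (h : idemLe g c) :
    cj (c * x) g = cj x g := by
  rw [← cj_cj]
  congr 1
  rw [cj, id_inv hc, le_left hg hc h]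
  exact h

theorem bypass_lem (L : LI S T) (n : ℕ) : ∀ (x : S) (y : T) (es : ℕ → S), L.toLB.M x y →
    es n = dm x → (∀ k ≤ n, Idm (es k)) →
    (∀ k : ℕ, 1 ≤ k → k ≤ n → idemLt (es (k - 1)) (es k) ∧ TightXCov (es k * x) (es (k - 1))) →
    L.ψ (cj x (es 0)) = cj y (L.ψ (es 0)) := by
  induction n with
  | zero =>
    intro x y es hM h0 _ _
    rw [h0, cj_dm, hM.2.2.1, cj_dm, hM.2.2.2]
  | succ n ih =>
    intro x y es hM hn hid hst
    have hc := hid n (by omega)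
    obtain ⟨h1, h2⟩ := hst (n + 1) (by omega) le_rfl
    rw [hn, dm_self, Nat.add_sub_cancel] at h2
    rw [hn, Nat.add_sub_cancel] at h1
    have hcx : idemLe (es n) (dm x) := h1.1
    have mono : ∀ k ≤ n, idemLe (es k) (es n) := by
      intro k hk
      obtain ⟨m, rfl⟩ := Nat.exists_eq_add_of_le hk
      have : ∀ j ≤ m, idemLe (es k) (es (k + j)) := by
        intro j
        induction j with
        | zero => intro _; exact hid k (by omega)
        | succ j ihj =>
          intro hj
          refine le_tr (ihj (by omega)) ?_
          exact (hst (k + j + 1) (by omega) (by omega)).1.1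
      exact this m le_rfl
    have h0 := mono 0 (by omega)
    have i0 := hid 0 (by omega)
    have h0' := (L.ord _ _ i0 hc).1 h0
    rw [← cj_restrict hc i0 x h0, ← cj_restrict (L.idm _ hc) (L.idm _ i0) y h0']
    rcases h2.2 with h3 | h3
    · refine ih (es n * x) (L.ψ (es n) * y) es (C_ns L hM hc h2.1 h3) (dm_cx hc hcx).symm
        (fun k hk => hid k (by omega)) ?_
      intro k hk1 hk2
      rw [← mul_assoc, mono k hk2]
      exact hst k hk1 (by omega)
    · rw [C_id L hM hc hcx h3]
      have h4 : es n * x = es n := by rw [← dm_id h3, dm_cx hc hcx]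
      have e : ∀ {R : Type _} [InverseSemigroup R] {a b : R}, Idm a → Idm b → idemLe b a →
          cj a b = b := by
        intro R _ a b ha hb hab
        rw [cj, id_inv ha, le_left hb ha hab]; exact hab
      rw [h4, e hc i0 h0]
      rw [cj, id_inv (L.idm _ hc), le_left (L.idm _ i0) (L.idm _ hc) h0']; exact h0'.symm

/-- compatible actions on idempotents -/
def Act (L : LI S T) (x : S) (y : T) : Prop := ∀ g, Idm g → L.ψ (cj x g) = cj y (L.ψ g)

theorem act_M (L : LI S T) (hTC : TightlyConnected S) {x : S} {y : T} (hM : L.toLB.M x y) :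
    Act L x y := by
  intro g hg
  have hi := id_mulmul hg (id_dm x)
  rw [← cj_res hg x, ← cj_res (L.idm _ hg) y, ← hM.2.2.1, ← L.psi_mul hg (id_dm x)]
  by_cases he : g * dm x = dm x
  · rw [he, cj_dm, hM.2.2.1, cj_dm, hM.2.2.2]
  · obtain ⟨n, -, es, h0, hn, hid, hst⟩ := hTC x (Or.inl hM.1) _ hi ⟨mul_le_r hg (id_dm x), he⟩
    rw [← h0]
    exact bypass_lem L n x y es hM hn hid hst

theorem act_id (L : LI S T) {e : S} (he : Idm e) : Act L e (L.ψ e) := by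
  intro g hg
  rw [cj, cj, id_inv he, id_inv (L.idm _ he), L.psi_mul (id_mulmul he hg) he, L.psi_mul he hg]

theorem act_mul {L : LI S T} {a b : S} {a' b' : T} (ha : Act L a a') (hb : Act L b b') :
    Act L (a * b) (a' * b') := by
  intro g hg
  rw [← cj_cj, ← cj_cj, hb _ (id_cj hg a), ha g hg]

theorem noiso (hNI : NoIsolatedNontrivial S) {a : S} (h : dm a = rn a) (hn : ¬ Idm a) :
    ∃ c ∈ NS S, dm c = dm a := by
  have hi := id_dm a
  obtain ⟨f, hf, hfe, c, h1, h2⟩ := hNI (dm a) hi ⟨a, fun h1 => hn (by rw [h1]; exact hi), by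
    constructor
    · show dm a = dm (dm a)
      rw [dm_id hi]
    · show rn a = rn (dm a)
      rw [rn_id hi, h]⟩
  have h1' : dm (dm a) = dm c := h1
  have h2' : rn c = rn f := h2
  rw [dm_id hi] at h1'
  rw [rn_id hf] at h2'
  refine ⟨c, ?_, h1'.symm⟩
  rw [ns_iff, ← h1', h2']; exact hfe.symm

theorem group_mul_ns {a c : S} (h : dm a = rn a) (hc : c ∈ NS S) (hd : dm c = dm a) :
    a * c ∈ NS S ∧ a = a * c * c⁻¹ := by
  constructor
  · rw [ns_iff, dm_mul_eq (by rw [hd, h]; exact id_rn a), rn_mul_eq (by rw [hd, h]; exact id_rn a),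
      ← hd]
    exact hc
  · rw [mul_assoc]
    show a = a * dm c
    rw [hd, h, rn_self]

theorem ex_act (L : LI S T) (hTC : TightlyConnected S) (hNI : NoIsolatedNontrivial S) (x : S) :
    ∃ y, Act L x y := by
  by_cases hx : x ∈ NS S
  · obtain ⟨y, hy⟩ := K_lem L hx
    exact ⟨y, act_M L hTC hy⟩
  · by_cases hi : Idm x
    · exact ⟨_, act_id L hi⟩
    · have hg : dm x = rn x := not_not.1 hx
      obtain ⟨c, hc, hd⟩ := noiso hNI hg hi
      obtain ⟨h1, h2⟩ := group_mul_ns hg hc hd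
      obtain ⟨y, hy⟩ := K_lem L h1
      obtain ⟨z, hz⟩ := K_lem L (ns_inv hc)
      rw [h2]
      exact ⟨y * z, act_mul (act_M L hTC hy) (act_M L hTC hz)⟩

theorem ex_act' (L : LI S T) (hTC : TightlyConnected S) (hNI : NoIsolatedNontrivial S) (y : T) :
    ∃ x, Act L x y := by
  by_cases hy : y ∈ NS T
  · obtain ⟨x, hx⟩ := K_symm L hy
    exact ⟨x, act_M L hTC hx⟩
  · by_cases hi : Idm y
    · refine ⟨L.ψi y, ?_⟩
      have := act_id L (L.idmi _ hi)
      rwa [L.right _ hi] at this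
    · have hg : dm y = rn y := not_not.1 hy
      have h1 : ∃ a, dm a = L.ψi (dm y) ∧ rn a = L.ψi (dm y) ∧ a ≠ L.ψi (dm y) := by
        by_contra hcon
        apply hi
        have hV : IsInvSub (Set.univ : Set S) :=
          ⟨fun _ _ _ _ => Set.mem_univ _, fun _ _ => Set.mem_univ _⟩
        have h2 : GG {y} ≤ L.Ψ ⟨Set.univ, hV⟩ := by
          rw [← OrderIso.symm_apply_le]; exact Set.subset_univ _
        have h3 := L.group_lem (GG1_le.1 h2) rfl hg.symm (by
          intro a _ h4 h5
          by_contra h6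
          exact hcon ⟨a, h4, h5, h6⟩)
        rw [h3]; exact id_dm y
      obtain ⟨a, ha1, ha2, ha3⟩ := h1
      obtain ⟨c, hc, hd⟩ := noiso hNI (ha1.trans ha2.symm) (fun h => ha3 (by rw [← ha1, dm_id h]))
      obtain ⟨u, hu⟩ := K_lem L hc
      obtain ⟨h1, h2⟩ := group_mul_ns hg hu.ns (by rw [← hu.2.2.1, hd, ha1, L.right _ (id_dm y)])
      obtain ⟨w, hw⟩ := K_symm L h1
      rw [h2]
      exact ⟨w * c⁻¹, act_mul (act_M L hTC hw) (act_M L hTC hu.inv)⟩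

theorem triv_act (L : LI S T) (hF : Fundamental S) {t : T} (hg : dm t = rn t)
    (ht : ∀ g, Idm g → cj t g = g * dm t) : t = dm t := by
  have hk := id_dm t
  have hVt : t ∈ (L.Ψ (L.Ψ.symm (GG {t}))).1 := by
    rw [OrderIso.apply_symm_apply]; exact gen1 t
  refine L.group_lem hVt rfl hg.symm ?_
  intro a ha h1 h2
  have he := L.idmi _ hk
  apply hF
  intro g hgi
  show cj a g = cj (L.ψi (dm t)) g
  have hi := id_mulmul hgi he
  have hr : cj (L.ψi (dm t)) g = g * L.ψi (dm t) := by
    rw [cj, id_inv he, id_comm he hgi, mul_assoc, he]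
  rw [hr, ← cj_res hgi a, h1]
  set e := L.ψi (dm t) with hedef
  set g1 := g * e with hg1
  have hle : idemLe g1 e := mul_le_r hgi he
  have hpe : L.ψ e = dm t := L.right _ hk
  have hle' : idemLe (L.ψ g1) (dm t) := by rw [← hpe, ← L.ord _ _ hi he]; exact hle
  have hgi' := L.idm _ hi
  have key : ∀ w ∈ genInv ({t, L.ψ g1} : Set T), ∀ q, (q = dm t ∨ q = L.ψ g1) →
      (cj w q = dm t ∨ cj w q = L.ψ g1) := by
    have e1 : cj t (L.ψ g1) = L.ψ g1 := by rw [ht _ hgi']; exact hle'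
    apply gen_ind
    · rintro w (rfl | rfl) q (rfl | rfl)
      · left; rw [cj_dm, hg]
      · right; exact e1
      · right; rw [cj, id_inv hgi', hle', hgi']
      · right; rw [cj, id_inv hgi', hgi', hgi']
    · rintro w (rfl | rfl) q (rfl | rfl)
      · left; rw [hg, ← dm_inv, cj_dm, rn_inv, dm_inv, hg]
      · right
        rw [← e1, cj_back hgi', e1]; exact hle'
      · right; rw [id_inv hgi', cj, id_inv hgi', hle', hgi']
      · right; rw [id_inv hgi', cj, id_inv hgi', hgi', hgi']
    · intro a b ha hb q hq
      rw [← cj_cj]; exact hb _ (ha q hq)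
  have hh := id_cj hi a
  have hmem : L.ψ (cj a g1) ∈ genInv ({t, L.ψ g1} : Set T) := by
    have h3 : cj a g1 ∈ (L.Ψ.symm (GG {t, L.ψ g1})).1 := by
      have h4 : a ∈ (L.Ψ.symm (GG {t, L.ψ g1})).1 := by
        have : L.Ψ.symm (GG {t}) ≤ L.Ψ.symm (GG {t, L.ψ g1}) := by
          rw [OrderIso.le_iff_le, GG1_le]; exact gen_self _ (by simp)
        exact this ha
      have h5 : g1 ∈ (L.Ψ.symm (GG {t, L.ψ g1})).1 := by
        rw [L.memi' _ hi]; exact gen_self _ (by simp)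
      have hs := (L.Ψ.symm (GG {t, L.ψ g1})).2
      exact hs.1 _ (hs.1 _ (hs.2 _ h4) _ h5) _ h4
    exact (L.memi' _ hh).1 h3
  have hlh : idemLe (L.ψ (cj a g1)) (dm t) := by
    rw [← hpe, ← L.ord _ _ hh he, ← h2]; exact cj_le hi a
  have h3 := key _ hmem (dm t) (Or.inl rfl)
  have h4 : cj (L.ψ (cj a g1)) (dm t) = L.ψ (cj a g1) := by
    have := L.idm _ hh
    rw [cj, id_inv this, hlh, this]
  rw [h4] at h3
  rcases h3 with h3 | h3
  · rw [← hpe] at h3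
    have h5 := L.inj hh he h3
    have h6 := cj_back hi a
    rw [h5, h1, hle, ← h2, ← dm_inv, cj_dm, rn_inv, h1] at h6
    rw [h5, h6]
  · exact L.inj hh hi h3

theorem fund_T (L : LI S T) (hF : Fundamental S) : Fundamental T := by
  intro y1 y2 h
  have h' : ∀ e, Idm e → cj y1 e = cj y2 e := h
  have hrn : rn y1 = rn y2 := by
    apply le_anti (id_rn _) (id_rn _)
    · rw [← cj_dm y1, h' _ (id_dm _)]; exact cj_le (id_dm _) _
    · rw [← cj_dm y2, ← h' _ (id_dm _)]; exact cj_le (id_dm _) _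
  have hb : ∀ y : T, cj y⁻¹ (rn y) = dm y := by
    intro y; rw [← dm_inv, cj_dm, rn_inv]
  have hdm : dm y1 = dm y2 := by
    apply le_anti (id_dm _) (id_dm _)
    · have h1 := cj_back (id_dm y2) y1
      rw [h' _ (id_dm _), cj_dm, ← hrn, hb] at h1
      rw [h1]; exact mul_le_l (id_dm _) (id_dm _)
    · have h1 := cj_back (id_dm y1) y2
      rw [← h' _ (id_dm _), cj_dm, hrn, hb] at h1
      rw [h1]; exact mul_le_l (id_dm _) (id_dm _)
  have h1 : dm (y1 * y2⁻¹) = dm y1 := dm_mul_eq (by rw [dm_inv, hrn]; exact id_rn _)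
  have h2 : rn (y1 * y2⁻¹) = dm y1 := by
    rw [rn_mul_eq (by rw [dm_inv, hrn]; exact id_rn _), rn_inv, hdm]
  have h3 := triv_act L hF (h1.trans h2.symm) (by
    intro g hg
    rw [← cj_cj, h' _ hg, cj_back hg, h1, hdm])
  rw [h1] at h3
  calc y1 = y1 * rn y1 := (rn_self y1).symm
    _ = y1 * y2⁻¹ * y2 := by rw [hrn, rn, mul_assoc]
    _ = y2 := by rw [h3, hdm, dm_self]

theorem main_iso (L : LI S T) (hTC : TightlyConnected S) (hF : Fundamental S)
    (hNI : NoIsolatedNontrivial S) :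
    ∃ φ : S → T, Function.Bijective φ ∧ ∀ a b : S, φ (a * b) = φ a * φ b := by
  have hFT := fund_T L hF
  have uniq : ∀ x y y', Act L x y → Act L x y' → y = y' := by
    intro x y y' h h'
    apply hFT
    intro e he
    have h1 := h _ (L.idmi e he)
    have h2 := h' _ (L.idmi e he)
    rw [L.right e he] at h1 h2
    exact h1.symm.trans h2
  choose φ hφ using ex_act L hTC hNI
  refine ⟨φ, ⟨?_, ?_⟩, ?_⟩
  · intro a b hab
    apply hF
    intro e he
    apply L.inj (id_cj he a) (id_cj he b)
    have h1 := hφ a e he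
    rw [hab, ← hφ b e he] at h1
    exact h1
  · intro y
    obtain ⟨x, hx⟩ := ex_act' L hTC hNI y
    exact ⟨x, uniq x _ _ (hφ x) hx⟩
  · intro a b
    exact uniq _ _ _ (hφ _) (act_mul (hφ a) (hφ b))

end MainIso
section FromPA

variable {S T : Type*} [InverseSemigroup S] [InverseSemigroup T]

/-- identity map on a subsemigroup -/
def idg (U : Sb S) : PA S := ⟨{p | p.1 = p.2 ∧ p.1 ∈ U.1}, by
  refine ⟨?_, ?_, ?_, ?_⟩
  · rintro ⟨a, b⟩ ⟨h1, _⟩ ⟨c, d⟩ ⟨h2, _⟩ h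
    exact h1.symm.trans (h.trans h2)
  · rintro ⟨a, b⟩ ⟨h1, _⟩ ⟨c, d⟩ ⟨h2, _⟩ h
    exact h1.trans (h.trans h2.symm)
  · rintro ⟨a, b⟩ ⟨h1, h1'⟩ ⟨c, d⟩ ⟨h2, h2'⟩
    have e1 : a = b := h1
    have e2 : c = d := h2
    subst e1; subst e2
    exact ⟨rfl, U.2.1 _ h1' _ h2'⟩
  · rintro ⟨a, b⟩ ⟨h1, h1'⟩
    have e1 : a = b := h1
    subst e1
    exact ⟨rfl, U.2.2 _ h1'⟩⟩

/-- fixed points -/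
def fxp (α : PA S) : Sb S := ⟨{a | (a, a) ∈ α.1},
  fun _ ha _ hb => α.2.2.2.1 _ ha _ hb, fun _ ha => α.2.2.2.2 _ ha⟩

theorem fxp_idg (U : Sb S) : fxp (idg U) = U := by
  apply Subtype.ext
  ext a
  exact ⟨fun h => h.2, fun h => ⟨rfl, h⟩⟩

theorem idg_fxp {α : PA S} (h : pacomp α α = α) : idg (fxp α) = α := by
  have h' : relComp α.1 α.1 = α.1 := congrArg Subtype.val h
  apply Subtype.ext
  ext ⟨a, b⟩
  constructor
  · rintro ⟨h1, h2⟩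
    have e1 : a = b := h1
    subst e1
    exact h2
  · intro hab
    have h1 := hab
    rw [← h'] at h1
    obtain ⟨c, h2, h3⟩ := h1
    have e1 : c = b := α.2.1 _ h2 _ hab rfl
    subst e1
    have e2 : a = c := α.2.2.1 _ hab _ h3 rfl
    subst e2
    exact ⟨rfl, hab⟩

theorem idg_comp_iff (U V : Sb S) : pacomp (idg U) (idg V) = idg U ↔ U ≤ V := by
  constructor
  · intro h a ha
    have h' : relComp (idg U).1 (idg V).1 = (idg U).1 := congrArg Subtype.val h
    have h1 : (a, a) ∈ (idg U).1 := ⟨rfl, ha⟩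
    rw [← h'] at h1
    obtain ⟨c, ⟨h2, _⟩, h3⟩ := h1
    have e1 : a = c := h2
    subst e1
    exact h3.2
  · intro h
    apply Subtype.ext
    ext ⟨a, b⟩
    constructor
    · rintro ⟨c, ⟨h2, h3⟩, ⟨h4, _⟩⟩
      exact ⟨h2.trans h4, h3⟩
    · rintro ⟨h1, h2⟩
      have e1 : a = b := h1
      subst e1
      exact ⟨a, ⟨rfl, h2⟩, rfl, h h2⟩

theorem idg_idem (U : Sb S) : pacomp (idg U) (idg U) = idg U := (idg_comp_iff U U).2 le_rfl

theorem phi_idg (Φ : PA S ≃ PA T) (hΦ : ∀ α β : PA S, Φ (pacomp α β) = pacomp (Φ α) (Φ β))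
    (U : Sb S) : idg (fxp (Φ (idg U))) = Φ (idg U) := by
  apply idg_fxp
  rw [← hΦ, idg_idem]

/-- induced lattice isomorphism -/
def latIso (Φ : PA S ≃ PA T) (hΦ : ∀ α β : PA S, Φ (pacomp α β) = pacomp (Φ α) (Φ β))
    (hΦ' : ∀ α β : PA T, Φ.symm (pacomp α β) = pacomp (Φ.symm α) (Φ.symm β)) : Sb S ≃o Sb T where
  toFun U := fxp (Φ (idg U))
  invFun V := fxp (Φ.symm (idg V))
  left_inv U := by
    show fxp (Φ.symm (idg (fxp (Φ (idg U))))) = U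
    rw [phi_idg Φ hΦ, Equiv.symm_apply_apply, fxp_idg]
  right_inv V := by
    show fxp (Φ (idg (fxp (Φ.symm (idg V))))) = V
    rw [phi_idg Φ.symm hΦ', Equiv.apply_symm_apply, fxp_idg]
  map_rel_iff' := by
    intro U V
    show fxp (Φ (idg U)) ≤ fxp (Φ (idg V)) ↔ U ≤ V
    rw [← idg_comp_iff, ← idg_comp_iff, phi_idg Φ hΦ, phi_idg Φ hΦ, ← hΦ, Φ.injective.eq_iff]

/-- empty subsemigroup -/
def emp (S : Type*) [InverseSemigroup S] : Sb S := ⟨∅, fun _ h => h.elim, fun _ h => h.elim⟩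

theorem emp_le (U : Sb S) : emp S ≤ U := Set.empty_subset _

theorem psi_emp (Ψ : Sb S ≃o Sb T) : Ψ (emp S) = emp T := by
  apply le_antisymm _ (emp_le _)
  rw [← OrderIso.le_symm_apply]; exact emp_le _

theorem atom_ex (Ψ : Sb S ≃o Sb T) {e : S} (he : Idm e) : ∃ e', Idm e' ∧ Ψ (GG {e}) = GG {e'} := by
  have h1 : ¬ Ψ (GG {e}) ≤ emp T := by
    rw [← psi_emp Ψ, OrderIso.le_iff_le]
    intro h
    exact h (gen1 e)
  obtain ⟨a, ha, -⟩ := Set.not_subset.1 h1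
  have hd := sub_dm (Ψ (GG {e})).2 ha
  refine ⟨dm a, id_dm a, le_antisymm ?_ (GG1_le.2 hd)⟩
  have h2 : Ψ.symm (GG {dm a}) ≤ GG {e} := by
    rw [OrderIso.symm_apply_le, GG1_le]; exact hd
  have h3 : ¬ Ψ.symm (GG {dm a}) ≤ emp S := by
    rw [← psi_emp Ψ.symm, OrderIso.le_iff_le]
    intro h
    exact h (gen1 (dm a))
  obtain ⟨b, hb, -⟩ := Set.not_subset.1 h3
  have h4 : b ∈ genInv ({e} : Set S) := h2 hb
  rw [gen_id he] at h4
  have h5 : b = e := h4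
  subst h5
  rw [← OrderIso.le_symm_apply, GG1_le]; exact hb

theorem GG_inj {e f : S} (he : Idm e) (hf : Idm f) (h : (GG {e} : Sb S) = GG {f}) : e = f := by
  have h1 : genInv ({e} : Set S) = genInv {f} := congrArg Subtype.val h
  rw [gen_id he, gen_id hf] at h1
  exact Set.singleton_injective h1

theorem ex_LB (Ψ : Sb S ≃o Sb T) : ∃ L : LB S T, L.Ψ = Ψ := by
  choose ψ h1 h2 using fun e : S => atom_ex Ψ (id_dm e)
  choose ψi h3 h4 using fun e : T => atom_ex Ψ.symm (id_dm e)
  refine ⟨⟨Ψ, ψ, ψi, fun e _ => h1 e, fun e _ => h3 e, ?_, ?_, ?_⟩, rfl⟩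
  · intro e he
    apply GG_inj (h3 _) he
    rw [← h4, dm_id (h1 e), ← h2, OrderIso.symm_apply_apply, dm_id he]
  · intro e he
    apply GG_inj (h1 _) he
    rw [← h2, dm_id (h3 e), ← h4, OrderIso.apply_symm_apply, dm_id he]
  · intro U e he
    rw [← GG1_le, ← GG1_le, ← h2 e, dm_id he, OrderIso.le_iff_le]

theorem transp (Φ : PA S ≃ PA T) (hΦ : ∀ α β : PA S, Φ (pacomp α β) = pacomp (Φ α) (Φ β))
    (L : LB S T) (hL : ∀ U, idg (L.Ψ U) = Φ (idg U)) (α : PA S) {e e2 : S} (he : Idm e)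
    (he2 : Idm e2) (h : (e, e2) ∈ α.1) : (L.ψ e, L.ψ e2) ∈ (Φ α).1 := by
  have h0 : Φ (idg (emp S)) = idg (emp T) := by rw [← hL, psi_emp]
  set β := pacomp (idg (GG {e})) (pacomp α (idg (GG {e2}))) with hβ
  have h1 : (e, e2) ∈ β.1 := ⟨e, ⟨rfl, gen1 e⟩, e2, h, rfl, gen1 e2⟩
  have h2 : Φ β ≠ idg (emp T) := by
    rw [← h0, Φ.injective.ne_iff]
    intro h3
    rw [h3] at h1
    exact h1.2
  have h3 : (Φ β).1.Nonempty := by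
    by_contra h4
    apply h2
    apply Subtype.ext
    rw [Set.not_nonempty_iff_eq_empty.1 h4]
    symm
    rw [Set.eq_empty_iff_forall_notMem]
    intro p hp
    exact hp.2
  rw [hβ, hΦ, hΦ, ← hL, ← hL, L.psi_id he, L.psi_id he2] at h3
  obtain ⟨⟨a, b⟩, c, ⟨h4, h5⟩, d, h6, h7, h8⟩ := h3
  have e1 : a = c := h4
  have e2' : d = b := h7
  subst e1; subst e2'
  have h5' : a ∈ genInv ({L.ψ e} : Set T) := h5
  have h8' : d ∈ genInv ({L.ψ e2} : Set T) := h8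
  rw [gen_id (L.idm _ he)] at h5'
  rw [gen_id (L.idm _ he2)] at h8'
  have h5'' : a = L.ψ e := h5'
  have h8'' : d = L.ψ e2 := h8'
  rw [← h5'', ← h8'']
  exact h6

theorem pair_pa {e f e2 f2 : S} (he : Idm e) (hf : Idm f) (he2 : Idm e2) (hf2 : Idm f2)
    (h : idemLe e f) (hne : e ≠ f) (h2 : idemLe e2 f2) (hne2 : e2 ≠ f2) :
    IsPAGraph ({(e, e2), (f, f2)} : Set (S × S)) := by
  have l1 : f * e = e := le_left he hf h
  have l2 : f2 * e2 = e2 := le_left he2 hf2 h2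
  have u1 : e * f = e := h
  have u2 : e2 * f2 = e2 := h2
  refine ⟨?_, ?_, ?_, ?_⟩
  · rintro p (rfl | rfl) q (rfl | rfl) hh
    · rfl
    · exact absurd hh hne
    · exact absurd hh.symm hne
    · rfl
  · rintro p (rfl | rfl) q (rfl | rfl) hh
    · rfl
    · exact absurd hh hne2
    · exact absurd hh.symm hne2
    · rfl
  · rintro p (rfl | rfl) q (rfl | rfl)
    · left; show (e * e, e2 * e2) = _; rw [he, he2]
    · left; show (e * f, e2 * f2) = _; rw [u1, u2]
    · left; show (f * e, f2 * e2) = _; rw [l1, l2]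
    · right; show (f * f, f2 * f2) = _; rw [hf, hf2]
  · rintro p (rfl | rfl)
    · left; show (e⁻¹, e2⁻¹) = _; rw [id_inv he, id_inv he2]
    · right; show (f⁻¹, f2⁻¹) = _; rw [id_inv hf, id_inv hf2]

theorem ord_transfer (Φ : PA S ≃ PA T) (hΦ : ∀ α β : PA S, Φ (pacomp α β) = pacomp (Φ α) (Φ β))
    (L : LB S T) (hL : ∀ U, idg (L.Ψ U) = Φ (idg U)) {e f e2 f2 : S} (he : Idm e) (hf : Idm f)
    (he2 : Idm e2) (hf2 : Idm f2)
    (h : idemLe e f) (hne : e ≠ f) (h2 : idemLe e2 f2) (hne2 : e2 ≠ f2)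
    (ho : idemLe (L.ψ e) (L.ψ f)) : idemLe (L.ψ e2) (L.ψ f2) := by
  let α : PA S := ⟨_, pair_pa he hf he2 hf2 h hne h2 hne2⟩
  have h3 := transp Φ hΦ L hL α he he2 (Or.inl rfl)
  have h4 := transp Φ hΦ L hL α hf hf2 (Or.inr rfl)
  have h5 := (Φ α).2.2.2.1 _ h3 _ h4
  exact (Φ α).2.1 _ h5 _ h3 ho

/-- comparable -/
def Cmp (e f : S) : Prop := idemLe e f ∨ idemLe f e

theorem cmp_pres (L : LB S T) {e f : S} (he : Idm e) (hf : Idm f) (h : Cmp e f) :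
    Cmp (L.ψ e) (L.ψ f) := by
  have hP : IsInvSub ({e, f} : Set S) := by
    constructor
    · rintro a (rfl | rfl) b (rfl | rfl)
      · left; exact he
      · rcases h with h | h
        · left; exact h
        · right; exact le_left hf he h
      · rcases h with h | h
        · left; exact le_left he hf h
        · right; exact h
      · right; exact hf
    · rintro a (rfl | rfl)
      · left; exact id_inv he
      · right; exact id_inv hf
  have he' := L.idm _ he
  have hf' := L.idm _ hf
  have hm := id_mulmul he' hf'
  have h1 : L.ψ e * L.ψ f ∈ (L.Ψ ⟨_, hP⟩).1 :=
    (L.Ψ ⟨_, hP⟩).2.1 _ ((L.mem _ _ he).1 (Or.inl rfl)) _ ((L.mem _ _ hf).1 (Or.inr rfl))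
  rw [L.memi _ hm] at h1
  have h0 := L.right _ hm
  rcases h1 with h1 | h1
  · have h2 : L.ψi (L.ψ e * L.ψ f) = e := h1
    rw [h2] at h0
    exact Or.inl h0.symm
  · have h2 : L.ψi (L.ψ e * L.ψ f) = f := h1
    rw [h2] at h0
    right
    show L.ψ f * L.ψ e = L.ψ f
    rw [id_comm hf' he']
    exact h0.symm

theorem cmp_refl (L : LB S T) {e f : S} (he : Idm e) (hf : Idm f) (h : Cmp (L.ψ e) (L.ψ f)) :
    Cmp e f := by
  have : Cmp (L.ψi (L.ψ e)) (L.ψi (L.ψ f)) := cmp_pres L.symm (L.idm _ he) (L.idm _ hf) h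
  rwa [L.left _ he, L.left _ hf] at this

theorem par_mul (L : LB S T) {e f : S} (he : Idm e) (hf : Idm f) (h : ¬ Cmp e f) :
    L.ψ (e * f) = L.ψ e * L.ψ f := by
  have hef := id_mulmul he hf
  have hP : IsInvSub ({e, f, e * f} : Set S) := by
    have a1 : e * (e * f) = e * f := id_mul' he f
    have a2 : f * (e * f) = e * f := by rw [id_comm he hf, id_mul' hf]
    have a3 : e * f * e = e * f := by rw [id_comm hef he, a1]
    have a4 : e * f * f = e * f := by rw [id_comm hef hf, a2]
    have a5 : f * e = e * f := id_comm hf he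
    constructor
    · rintro a (rfl | rfl | rfl) b (rfl | rfl | rfl)
      · left; exact he
      · right; right; rfl
      · right; right; exact a1
      · right; right; exact a5
      · right; left; exact hf
      · right; right; exact a2
      · right; right; exact a3
      · right; right; exact a4
      · right; right; exact hef
    · rintro a (rfl | rfl | rfl)
      · left; exact id_inv he
      · right; left; exact id_inv hf
      · right; right; exact id_inv hef
  have he' := L.idm _ he
  have hf' := L.idm _ hf
  have hm := id_mulmul he' hf'
  have h1 : L.ψ e * L.ψ f ∈ (L.Ψ ⟨_, hP⟩).1 :=
    (L.Ψ ⟨_, hP⟩).2.1 _ ((L.mem _ _ he).1 (Or.inl rfl)) _ ((L.mem _ _ hf).1 (Or.inr (Or.inl rfl)))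
  rw [L.memi _ hm] at h1
  have h0 := L.right _ hm
  rcases h1 with h1 | h1 | h1
  · exfalso
    rw [h1] at h0
    exact h (cmp_refl L he hf (Or.inl h0.symm))
  · exfalso
    have h2 : L.ψi (L.ψ e * L.ψ f) = f := h1
    rw [h2] at h0
    refine h (cmp_refl L he hf (Or.inr ?_))
    show _ * _ = _
    rw [id_comm hf' he']
    exact h0.symm
  · have h2 : L.ψi (L.ψ e * L.ψ f) = e * f := h1
    rw [h2] at h0
    exact h0

/-- the reversed case forces semilattices -/
theorem rev_case (L : LB S T) (hNI : NoIsolatedNontrivial S)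
    (htot : ∀ e f : S, Idm e → Idm f → Cmp e f)
    (hrev : ∀ e f : S, Idm e → Idm f → (idemLe e f ↔ idemLe (L.ψ f) (L.ψ e))) :
    (∀ x : S, Idm x) ∧ ∀ y : T, Idm y := by
  have htot' : ∀ e f : T, Idm e → Idm f → Cmp e f := by
    intro e f he hf
    have := cmp_pres L (L.idmi _ he) (L.idmi _ hf) (htot _ _ (L.idmi _ he) (L.idmi _ hf))
    rwa [L.right _ he, L.right _ hf] at this
  have h1 : L.Ψ.symm ⟨ES T, sub_es⟩ ≤ ⟨ES S, sub_es⟩ := by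
    rw [OrderIso.symm_apply_le]
    intro e he
    rw [L.memi _ he]
    exact L.idmi _ he
  have hS : ∀ x : S, Idm x := by
    intro x0
    by_contra hx0
    have h2 : ∃ x ∈ NS S, True := by
      by_cases h3 : x0 ∈ NS S
      · exact ⟨x0, h3, trivial⟩
      · obtain ⟨c, hc, -⟩ := noiso hNI (not_not.1 h3) hx0
        exact ⟨c, hc, trivial⟩
    have h3 : ∃ x ∈ NS S, idemLe (rn x) (dm x) := by
      obtain ⟨x, hx, -⟩ := h2
      rcases htot _ _ (id_rn x) (id_dm x) with h4 | h4
      · exact ⟨x, hx, h4⟩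
      · exact ⟨x⁻¹, ns_inv hx, by rwa [rn_inv, dm_inv]⟩
    obtain ⟨x, hx, hle⟩ := h3
    have h4 : ¬ L.Ψ (GG {x}) ≤ ⟨ES T, sub_es⟩ := by
      intro h5
      rw [← OrderIso.le_symm_apply] at h5
      exact not_ns_id (GG1_le.1 (h5.trans h1)) hx
    obtain ⟨z0, hz0, hz0'⟩ := Set.not_subset.1 h4
    have hz0n : z0 ∈ NS T := fun h5 => hz0' (comb_img L hle hx z0 hz0 h5)
    have h5 : ∃ z ∈ (L.Ψ (GG {x})).1, z ∈ NS T ∧ idemLe (rn z) (dm z) := by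
      rcases htot' _ _ (id_rn z0) (id_dm z0) with h6 | h6
      · exact ⟨z0, hz0, hz0n, h6⟩
      · exact ⟨z0⁻¹, (L.Ψ (GG {x})).2.2 _ hz0, ns_inv hz0n, by rwa [rn_inv, dm_inv]⟩
    obtain ⟨z, hz, hzn, hzle⟩ := h5
    have ho := om_bi hle hx
    have hoz := om_bi hzle hzn
    have h6 : ∀ n, ∃ k, L.ψi (bep z n) = bep x k := by
      intro n
      have h7 : bep z n ∈ (L.Ψ (GG {x})).1 := gen1_le (L.Ψ (GG {x})).2 hz (hoz.mem n)
      rw [L.memi _ (id_bep z n)] at h7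
      exact ho.all _ h7 (L.idmi _ (id_bep z n))
    choose k hk using h6
    have h7 : ∀ n, k (n + 1) < k n := by
      intro n
      have h8 : k (n + 1) ≤ k n := by
        rw [← ho.le_iff, ← hk, ← hk, hrev _ _ (L.idmi _ (id_bep z _)) (L.idmi _ (id_bep z _)),
          L.right _ (id_bep z _), L.right _ (id_bep z _)]
        exact bep_le hzle n
      refine lt_of_le_of_ne h8 ?_
      intro h9
      have h10 : L.ψi (bep z (n + 1)) = L.ψi (bep z n) := by rw [hk, hk, h9]
      exact bep_ne hzle hzn n (L.symm.inj (id_bep z _) (id_bep z _) h10)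
    have h8 : ∀ n, k n + n ≤ k 0 := by
      intro n
      induction n with
      | zero => simp
      | succ n ih => have := h7 n; omega
    have := h8 (k 0 + 1)
    omega
  refine ⟨hS, ?_⟩
  intro y
  have h2 : L.Ψ.symm (GG {y}) ≤ L.Ψ.symm ⟨ES T, sub_es⟩ := by
    intro a _
    rw [L.memi' _ (hS a)]
    exact L.idm _ (hS a)
  rw [OrderIso.le_iff_le, GG1_le] at h2
  exact h2

theorem natLe_idem (hS : ∀ x : S, Idm x) (a b : S) : natLe a b ↔ idemLe a b := by
  constructor
  · rintro ⟨e, _, rfl⟩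
    exact mul_le_r (hS e) (hS b)
  · intro h
    exact ⟨a, hS a, Eq.symm h⟩

theorem hard_dir (hTC : TightlyConnected S) (hF : Fundamental S) (hNI : NoIsolatedNontrivial S)
    (Φ : PA S ≃ PA T) (hΦ : ∀ α β : PA S, Φ (pacomp α β) = pacomp (Φ α) (Φ β)) :
    ((∃ φ : S → T, Function.Bijective φ ∧ ∀ a b : S, φ (a * b) = φ a * φ b) ∨
        ((∀ a b : S, natLe a b ∨ natLe b a) ∧ (∀ a b : T, natLe a b ∨ natLe b a) ∧
          ∃ δ : S → T, Function.Bijective δ ∧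
            ∀ a b : S, natLe a b ↔ natLe (δ b) (δ a))) := by
  have hΦ' : ∀ α β : PA T, Φ.symm (pacomp α β) = pacomp (Φ.symm α) (Φ.symm β) := by
    intro α β
    apply Φ.injective
    rw [hΦ, Equiv.apply_symm_apply, Equiv.apply_symm_apply, Equiv.apply_symm_apply]
  obtain ⟨L, hLΨ⟩ := ex_LB (latIso Φ hΦ hΦ')
  have hL : ∀ U, idg (L.Ψ U) = Φ (idg U) := by
    intro U
    rw [hLΨ]; exact phi_idg Φ hΦ U
  by_cases hA : ∃ e f : S, Idm e ∧ Idm f ∧ idemLe e f ∧ e ≠ f ∧ idemLe (L.ψ e) (L.ψ f)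
  · left
    obtain ⟨e, f, he, hf, hef, hne, ho⟩ := hA
    have pres : ∀ a b, Idm a → Idm b → idemLe a b → idemLe (L.ψ a) (L.ψ b) := by
      intro a b ha hb hab
      by_cases h : a = b
      · subst h; exact L.idm _ ha
      · exact ord_transfer Φ hΦ L hL he hf ha hb hef hne hab h ho
    refine main_iso ⟨L, ?_⟩ hTC hF hNI
    intro a b ha hb
    refine ⟨pres a b ha hb, fun h => ?_⟩
    rcases cmp_refl L ha hb (Or.inl h) with h1 | h1
    · exact h1
    · have h2 := L.inj ha hb (le_anti (L.idm _ ha) (L.idm _ hb) h (pres b a hb ha h1))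
      subst h2; exact ha
  · right
    have rev : ∀ a b, Idm a → Idm b → idemLe a b → idemLe (L.ψ b) (L.ψ a) := by
      intro a b ha hb hab
      by_cases h : a = b
      · subst h; exact L.idm _ ha
      · exact (cmp_pres L ha hb (Or.inl hab)).resolve_left
          (fun h1 => hA ⟨a, b, ha, hb, hab, h, h1⟩)
    have htot : ∀ e f : S, Idm e → Idm f → Cmp e f := by
      intro e f he hf
      by_contra h
      have h1 := rev _ _ (id_mulmul he hf) he (mul_le_l he hf)
      rw [par_mul L he hf h] at h1
      exact h (cmp_refl L he hf (Or.inl (le_tr h1 (mul_le_r (L.idm _ he) (L.idm _ hf)))))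
    have hrev : ∀ e f : S, Idm e → Idm f → (idemLe e f ↔ idemLe (L.ψ f) (L.ψ e)) := by
      intro a b ha hb
      refine ⟨rev a b ha hb, fun h => ?_⟩
      rcases htot a b ha hb with h1 | h1
      · exact h1
      · have h2 := L.inj hb ha (le_anti (L.idm _ hb) (L.idm _ ha) h (rev b a hb ha h1))
        subst h2; exact ha
    obtain ⟨hS, hT⟩ := rev_case L hNI htot hrev
    refine ⟨fun a b => ?_, fun a b => ?_, L.ψ, ⟨fun a b h => L.inj (hS a) (hS b) h,
      fun y => ⟨L.ψi y, L.right _ (hT y)⟩⟩, fun a b => ?_⟩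
    · rw [natLe_idem hS, natLe_idem hS]; exact htot a b (hS a) (hS b)
    · rw [natLe_idem hT, natLe_idem hT]
      have := cmp_pres L (hS (L.ψi a)) (hS (L.ψi b)) (htot _ _ (hS _) (hS _))
      rwa [L.right _ (hT a), L.right _ (hT b)] at this
    · rw [natLe_idem hS, natLe_idem hT]; exact hrev a b (hS a) (hS b)

/-- transport of partial automorphisms -/
theorem easy_dir (δ : S ≃ T)
    (h1 : ∀ α : Set (S × S), IsPAGraph α → IsPAGraph {p : T × T | (δ.symm p.1, δ.symm p.2) ∈ α})
    (h2 : ∀ α : Set (T × T), IsPAGraph α → IsPAGraph {p : S × S | (δ p.1, δ p.2) ∈ α}) :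
    ∃ Φ : PA S ≃ PA T, ∀ α β : PA S, Φ (pacomp α β) = pacomp (Φ α) (Φ β) := by
  refine ⟨⟨fun α => ⟨_, h1 α.1 α.2⟩, fun β => ⟨_, h2 β.1 β.2⟩, ?_, ?_⟩, ?_⟩
  · intro α
    apply Subtype.ext
    ext ⟨a, b⟩
    simp
  · intro α
    apply Subtype.ext
    ext ⟨a, b⟩
    simp
  · intro α β
    apply Subtype.ext
    ext ⟨a, b⟩
    constructor
    · rintro ⟨c, h3, h4⟩
      refine ⟨δ c, ?_, ?_⟩
      · show (δ.symm a, δ.symm (δ c)) ∈ α.1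
        rw [Equiv.symm_apply_apply]; exact h3
      · show (δ.symm (δ c), δ.symm b) ∈ β.1
        rw [Equiv.symm_apply_apply]; exact h4
    · rintro ⟨c, h3, h4⟩
      exact ⟨δ.symm c, h3, h4⟩

theorem pull_hom (γ : T → S) (hi : Function.Injective γ) (hm : ∀ a b, γ (a * b) = γ a * γ b)
    (α : Set (S × S)) (h : IsPAGraph α) : IsPAGraph {p : T × T | (γ p.1, γ p.2) ∈ α} := by
  have hinv : ∀ a, γ a⁻¹ = (γ a)⁻¹ := by
    intro a
    apply is_uniq
    · rw [← hm, ← hm, InverseSemigroup.mul_inv_mul]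
    · rw [← hm, ← hm, InverseSemigroup.inv_mul_inv]
  refine ⟨?_, ?_, ?_, ?_⟩
  · intro p hp q hq hpq
    exact hi (h.1 _ hp _ hq (congrArg γ hpq))
  · intro p hp q hq hpq
    exact hi (h.2.1 _ hp _ hq (congrArg γ hpq))
  · intro p hp q hq
    show (γ (p.1 * q.1), γ (p.2 * q.2)) ∈ α
    rw [hm, hm]; exact h.2.2.1 _ hp _ hq
  · intro p hp
    show (γ p.1⁻¹, γ p.2⁻¹) ∈ α
    rw [hinv, hinv]; exact h.2.2.2 _ hp

theorem pull_anti (γ : T → S) (hi : Function.Injective γ) (hS : ∀ x : S, Idm x)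
    (hT : ∀ x : T, Idm x) (ht : ∀ a b : T, idemLe a b ∨ idemLe b a)
    (hm : ∀ a b, idemLe a b ↔ idemLe (γ b) (γ a))
    (α : Set (S × S)) (h : IsPAGraph α) : IsPAGraph {p : T × T | (γ p.1, γ p.2) ∈ α} := by
  have key : ∀ p q : T × T, (γ p.1, γ p.2) ∈ α → (γ q.1, γ q.2) ∈ α → idemLe p.1 q.1 →
      idemLe p.2 q.2 := by
    intro p q hp hq hpq
    rw [hm] at hpq ⊢
    exact h.1 _ (h.2.2.1 _ hq _ hp) _ hq hpq
  refine ⟨?_, ?_, ?_, ?_⟩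
  · intro p hp q hq hpq
    exact hi (h.1 _ hp _ hq (congrArg γ hpq))
  · intro p hp q hq hpq
    exact hi (h.2.1 _ hp _ hq (congrArg γ hpq))
  · intro p hp q hq
    show (γ (p.1 * q.1), γ (p.2 * q.2)) ∈ α
    rcases ht p.1 q.1 with h1 | h1
    · have h2 := key p q hp hq h1
      rw [h1, h2]; exact hp
    · have h2 := key q p hq hp h1
      rw [le_left (hT _) (hT _) h1, le_left (hT _) (hT _) h2]; exact hq
  · intro p hp
    show (γ p.1⁻¹, γ p.2⁻¹) ∈ α
    rw [id_inv (hT _), id_inv (hT _)]; exact hp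

theorem chain_idem (h : ∀ a b : S, natLe a b ∨ natLe b a) (a : S) : Idm a := by
  rcases h a (dm a) with ⟨e, he, h1⟩ | ⟨e, he, h1⟩
  · rw [h1]; exact id_mulmul he (id_dm a)
  · have h2 : dm a = a⁻¹ * e := by
      rw [← id_inv (id_dm a), h1, is_mul_inv, id_inv he]
    have h3 : a = cj a e := by
      calc a = dm a * a := (dm_self a).symm
        _ = cj a e := by rw [h2, cj]
    rw [h3]; exact id_cj he a

theorem easy_all
    (h : (∃ φ : S → T, Function.Bijective φ ∧ ∀ a b : S, φ (a * b) = φ a * φ b) ∨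
        ((∀ a b : S, natLe a b ∨ natLe b a) ∧ (∀ a b : T, natLe a b ∨ natLe b a) ∧
          ∃ δ : S → T, Function.Bijective δ ∧
            ∀ a b : S, natLe a b ↔ natLe (δ b) (δ a))) :
    ∃ Φ : PA S ≃ PA T, ∀ α β : PA S, Φ (pacomp α β) = pacomp (Φ α) (Φ β) := by
  rcases h with ⟨φ, hb, hm⟩ | ⟨hS, hT, φ, hb, hm⟩
  · let δ := Equiv.ofBijective φ hb
    have hδ : ∀ a b, δ (a * b) = δ a * δ b := hm
    refine easy_dir δ (pull_hom δ.symm δ.symm.injective ?_) (pull_hom δ δ.injective hδ)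
    intro a b
    rw [Equiv.symm_apply_eq, hδ, Equiv.apply_symm_apply, Equiv.apply_symm_apply]
  · let δ := Equiv.ofBijective φ hb
    have iS := chain_idem hS
    have iT := chain_idem hT
    have hδ : ∀ a b, idemLe a b ↔ idemLe (δ b) (δ a) := by
      intro a b
      rw [← natLe_idem iS, ← natLe_idem iT]; exact hm a b
    refine easy_dir δ (pull_anti δ.symm δ.symm.injective iS iT ?_ ?_)
      (pull_anti δ δ.injective iT iS ?_ hδ)
    · intro a b
      rw [← natLe_idem iT, ← natLe_idem iT]; exact hT a b
    · intro a b
      rw [hδ, Equiv.apply_symm_apply, Equiv.apply_symm_apply]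
    · intro a b
      rw [← natLe_idem iS, ← natLe_idem iS]; exact hS a b

end FromPA

/-- for a tightly connected fundamental inverse semigroup `S` with no
isolated nontrivial subgroups and an inverse semigroup `T`, the monoids `PA S` and
`PA T` are isomorphic iff either `S ≅ T`, or `(S, ≤)` and `(T, ≤)` are chains for
their natural partial orders and there is a dual order-isomorphism of `(S, ≤)`
onto `(T, ≤)`. -/
theorem stmt9 {S T : Type*} [InverseSemigroup S] [InverseSemigroup T]
    (hTC : TightlyConnected S) (hF : Fundamental S) (hNI : NoIsolatedNontrivial S) :
    (∃ Φ : PA S ≃ PA T, ∀ α β : PA S, Φ (pacomp α β) = pacomp (Φ α) (Φ β)) ↔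
      ((∃ φ : S → T, Function.Bijective φ ∧ ∀ a b : S, φ (a * b) = φ a * φ b) ∨
        ((∀ a b : S, natLe a b ∨ natLe b a) ∧ (∀ a b : T, natLe a b ∨ natLe b a) ∧
          ∃ δ : S → T, Function.Bijective δ ∧
            ∀ a b : S, natLe a b ↔ natLe (δ b) (δ a))) := by
  constructor
  · rintro ⟨Φ, hΦ⟩
    exact hard_dir hTC hF hNI Φ hΦ
  · exact easy_all
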